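/- Let g > 1 be an integer and let m = (m₁, m₂, …, m_n) be a partition of 2g + n − 2 such that m_i ≥ 2 for each i ∈ {1,…,n}. Then |⟨F_{m₁} | F_{m₂} | ⋯ | F_{m_n}⟩ − 2 · |m|!| ≤ 2^{2^{200}} · (|m| − 1)!. In particular, since |m| = 2g + n − 2 ≥ g, the quantity c(m) = (1/|m|!) · ⟨F_{m₁}|⋯|F_{m_n}⟩ / ∏_{i=1}^n m_i satisfies |c(m) · ∏_{i=1}^n m_i − 2| ≤ 2^{2^{200}} / g. -/

import Mathlib

open Nat Finset

attribute [local instance] Classical.propDecidable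

/-- The series `ζ(k) = Σ_{j=1}^∞ j^{−k}` (convergent for `k ≥ 2`). -/
noncomputable def zetaSeries (k : ℤ) : ℝ :=
  ∑' j : ℕ, ((j : ℝ) + 1) ^ (-k)

/-- `𝔷(k) = (2 − 2^{2−k}) ζ(k)` for even integers `k ≥ 2`, `𝔷(0) = 1`, and `𝔷(k) = 0`
for all other integers `k` (in particular for odd or negative `k`). -/
noncomputable def zed (k : ℤ) : ℝ :=
  if k = 0 then 1
  else if 2 ≤ k ∧ Even k then (2 - (2 : ℝ) ^ (2 - k)) * zetaSeries k
  else 0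

/-- `P` is a (reduced) set partition of the finite set `S`: a collection of nonempty
disjoint subsets of `S` whose union is `S` (each element of `S` lies in exactly one
component). -/
def IsSetPartitionOn {ι : Type*} [DecidableEq ι] (S : Finset ι) (P : Finset (Finset ι)) :
    Prop :=
  (∀ s ∈ P, s ⊆ S ∧ s ≠ ∅) ∧ ∀ x ∈ S, ∃! s, s ∈ P ∧ x ∈ s

/-- `P` refines `Q`: every component of `P` is contained in a component of `Q`. -/
def Refines {ι : Type*} (P Q : Finset (Finset ι)) : Prop :=
  ∀ s ∈ P, ∃ t ∈ Q, s ⊆ t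

/-- Two set partitions `α`, `β` of a finite type `ι` (with `n = |ι|` elements) are
complementary if `ℓ(α) + ℓ(β) = n + 1` and the minimal set partition refined by both
`α` and `β` is the maximal (one-component) set partition; equivalently, the only common
coarsening of `α` and `β` is the one-component partition. -/
def IsComplementary {ι : Type*} [Fintype ι] [DecidableEq ι]
    (α β : Finset (Finset ι)) : Prop :=
  α.card + β.card = Fintype.card ι + 1 ∧
    ∀ γ : Finset (Finset ι), IsSetPartitionOn Finset.univ γ →
      Refines α γ → Refines β γ → γ = {Finset.univ}

/-- The quantity `E(m)` of Eskin–Okounkov, for a weight function `v` on a finite ground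
set `S`:
`E = Σ_{P partition of S, ℓ(P) ≥ 2} (−1)^{ℓ(P)−1} (ℓ(P)−2)!
      Σ_{d : P → ℕ, Σ d = ℓ(P)−2} ∏_{s ∈ P} (1/d_s!) · |v_s|! · 𝔷(|v_s| − |s| − d_s + 1)`,
where `|v_s| = Σ_{x ∈ s} v(x)` and `|s|` is the cardinality of the component `s`. -/
noncomputable def Emap {ι : Type*} [Fintype ι] [DecidableEq ι]
    (S : Finset ι) (v : ι → ℕ) : ℝ :=
  ∑ P ∈ Finset.univ.filter
      (fun P : Finset (Finset ι) => IsSetPartitionOn S P ∧ 2 ≤ P.card),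
    (-1 : ℝ) ^ (P.card - 1) * ((P.card - 2)! : ℝ) *
      ∑ d ∈ Finset.finsuppAntidiag P (P.card - 2),
        ∏ s ∈ P,
          (1 / ((d s)! : ℝ) * ((∑ x ∈ s, v x)! : ℝ) *
            zed ((∑ x ∈ s, v x : ℤ) - s.card - d s + 1))

/-- The single-bracket inner product `⟨m⟩ = |m|! · 𝔷(|m| − n + 2) + E(m)`, where the
entries of the tuple `m` are the values of `v` on the `n`-element ground set `S`. -/
noncomputable def innerSingle {ι : Type*} [Fintype ι] [DecidableEq ι]
    (S : Finset ι) (v : ι → ℕ) : ℝ :=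
  ((∑ x ∈ S, v x)! : ℝ) * zed ((∑ x ∈ S, v x : ℤ) - S.card + 2) + Emap S v

/-- The multi-fold inner product `⟨p_{λ^(1)} | ⋯ | p_{λ^(n)}⟩`.  The data of the
partitions `λ^(1), …, λ^(n)` is encoded by a ground set `ι` of size `L` (positions of
all parts), the value map `v : ι → ℕ` recording the parts, and the set partition `ρ`
of `ι` whose components group the positions belonging to the same `λ^(j)`.  Then
`⟨p_{λ^(1)} | ⋯ | p_{λ^(n)}⟩ = Σ_{α ∈ 𝒞(ρ)} ∏_{s ∈ α} ⟨λ_s⟩`, the sum running over set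
partitions `α` of `ι` complementary to `ρ`, where `λ_s` is the tuple of parts at the
positions in the component `s`. -/
noncomputable def innerMulti {ι : Type*} [Fintype ι] [DecidableEq ι]
    (ρ : Finset (Finset ι)) (v : ι → ℕ) : ℝ :=
  ∑ α ∈ Finset.univ.filter
      (fun α : Finset (Finset ι) =>
        IsSetPartitionOn Finset.univ α ∧ IsComplementary ρ α),
    ∏ s ∈ α, innerSingle s v

/-- The finite set of all partitions, encoded as multisets of positive integers, of
weight `w` (i.e. with `|λ| + ℓ(λ) = w`).  Adding `1` to each part is a bijection between
such partitions and the partitions of `w` all of whose parts are `≥ 2`, which is used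
here to realize this family as a `Finset`. -/
noncomputable def partitionsOfWeight (w : ℕ) : Finset (Multiset ℕ) :=
  ((Finset.univ : Finset (Nat.Partition w)).filter fun μ => ∀ p ∈ μ.parts, 2 ≤ p).image
    fun μ => μ.parts.map fun p => p - 1

/-- The inner product `⟨F_{m₁} | ⋯ | F_{m_n}⟩` (with `F_k = k·𝔣_k`):
`Σ_{wt(λ^(1)) = m₁+1} ⋯ Σ_{wt(λ^(n)) = m_n+1} ⟨p_{λ^(1)}|…|p_{λ^(n)}⟩ ·
  ∏_j (−m_j)^{ℓ(λ^(j))−1} / ∏_{i ≥ 1} M_i(λ^(j))!`.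
For each tuple `T` of partitions, the multi-fold inner product is computed on the
ground set `Σ j, Fin ℓ(T j)` with `ρ` the partition into the fibers of the first
projection and the value map enumerating the parts of each `T j`. -/
noncomputable def innerF {n : ℕ} (m : Fin n → ℕ) : ℝ :=
  ∑ T ∈ Fintype.piFinset fun j : Fin n => partitionsOfWeight (m j + 1),
    innerMulti
      (Finset.univ.image fun j : Fin n =>
        Finset.univ.filter fun x : Σ j : Fin n, Fin (T j).toList.length => x.1 = j)
      (fun x => (T x.1).toList.get x.2) *
      ∏ j, ((-(m j : ℝ)) ^ (Multiset.card (T j) - 1) /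
        ∏ i ∈ (T j).toFinset, (((T j).count i)! : ℝ))


theorem choose_two_le_choose {b j : ℕ} (h2 : 2 ≤ j) (hj : j + 2 ≤ b) :
    b.choose 2 ≤ b.choose j := by
  have key : ∀ i, 2 ≤ i → i ≤ b / 2 → b.choose 2 ≤ b.choose i := by
    intro i hi
    induction i, hi using Nat.le_induction with
    | base => intro _; exact le_rfl
    | succ i hi ih =>
      intro h
      exact (ih (by omega)).trans (Nat.choose_le_succ_of_lt_half_left (by omega))
  rcases le_or_gt j (b / 2) with h | h
  · exact key j h2 h
  · rw [← Nat.choose_symm (show j ≤ b by omega)]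
    exact key (b - j) (by omega) (by omega)

theorem sum_inv_choose_interior_le {b : ℕ} (hb : 2 ≤ b) :
    ∑ j ∈ Finset.range (b + 1), (if j = 0 ∨ j = b then (0 : ℝ) else 1 / (b.choose j : ℝ))
      ≤ 4 / b := by
  have hb' : (2 : ℝ) ≤ b := by exact_mod_cast hb
  have hb1 : (0 : ℝ) < (b : ℝ) - 1 := by linarith
  have hpt : ∀ j ∈ Finset.range (b + 1),
      (if j = 0 ∨ j = b then (0 : ℝ) else 1 / (b.choose j : ℝ)) ≤
        (if j = 1 then (1 : ℝ) / b else 0) + (if j = b - 1 then (1 : ℝ) / b else 0) +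
          (if j = 0 ∨ j = b then (0 : ℝ) else 2 / (b * (b - 1))) := by
    intro j hj
    have hjb : j ≤ b := by simpa [Nat.lt_succ_iff] using hj
    have h0 : (0 : ℝ) ≤ 1 / b := by positivity
    have h3 : (0 : ℝ) ≤ 2 / (b * (b - 1)) := by positivity
    by_cases he : j = 0 ∨ j = b
    · simp only [he, if_true]
      split_ifs <;> linarith
    · simp only [he, if_false]
      push Not at he
      by_cases h1 : j = 1
      · subst h1
        simp only [Nat.choose_one_right, if_true]
        split_ifs <;> linarith
      by_cases h2 : j = b - 1
      · subst h2
        have : b.choose (b - 1) = b := by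
          rw [← Nat.choose_symm (by omega), Nat.sub_sub_self (by omega), Nat.choose_one_right]
        simp only [this, if_true]
        split_ifs
        all_goals linarith
      · simp only [h1, h2, if_false, zero_add]
        have hc := choose_two_le_choose (b := b) (j := j) (by omega) (by omega)
        have hc' : (b : ℝ) * (b - 1) / 2 ≤ (b.choose j : ℝ) := by
          rw [← Nat.cast_choose_two]; exact_mod_cast hc
        have hpos : (0 : ℝ) < b * (b - 1) / 2 := by positivity
        calc 1 / (b.choose j : ℝ) ≤ 1 / (b * (b - 1) / 2) :=
              one_div_le_one_div_of_le hpos hc'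
          _ = 2 / (b * (b - 1)) := by field_simp
  have hcount : ∑ j ∈ Finset.range (b + 1),
      (if j = 0 ∨ j = b then (0 : ℝ) else 2 / (b * (b - 1))) = 2 / b := by
    rw [Finset.sum_range_succ, Finset.sum_range_eq_add_Ico _ (by omega)]
    have : ∑ j ∈ Finset.Ico 1 b, (if j = 0 ∨ j = b then (0 : ℝ) else 2 / (b * (b - 1)))
        = ∑ j ∈ Finset.Ico 1 b, (2 / ((b : ℝ) * (b - 1))) := by
      refine Finset.sum_congr rfl fun j hj => ?_
      have := Finset.mem_Ico.1 hj
      rw [if_neg (by omega)]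
    rw [this]
    simp only [Finset.sum_const, Nat.card_Ico, nsmul_eq_mul, true_or, or_true, if_true]
    rw [Nat.cast_sub (by omega)]
    field_simp
    push_cast
    ring
  refine (Finset.sum_le_sum hpt).trans ?_
  rw [Finset.sum_add_distrib, Finset.sum_add_distrib, hcount]
  simp only [Finset.sum_ite_eq', Finset.mem_range]
  rw [if_pos (by omega), if_pos (by omega)]
  apply le_of_eq
  field_simp
  norm_num

/-- The quantity `A! B! / (A + B - 1)!` is antitone in both variables. -/
theorem factorial_mul_factorial_antitone {A B u y : ℕ} (hA : 1 ≤ A) (hB : 1 ≤ B)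
    (hu : A ≤ u) (hy : B ≤ y) :
    u ! * y ! * (A + B - 1)! ≤ (u + y - 1)! * (A ! * B !) := by
  have step1 : u ! * B ! * (A + B - 1)! ≤ (u + B - 1)! * (A ! * B !) := by
    induction u, hu using Nat.le_induction with
    | base => exact le_of_eq (by ring)
    | succ u hu ih =>
      have e : u + 1 + B - 1 = (u + B - 1) + 1 := by omega
      rw [e, Nat.factorial_succ u, Nat.factorial_succ (u + B - 1)]
      calc (u + 1) * u ! * B ! * (A + B - 1)! = (u + 1) * (u ! * B ! * (A + B - 1)!) := by ring
        _ ≤ (u + B - 1 + 1) * ((u + B - 1)! * (A ! * B !)) :=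
            Nat.mul_le_mul (by omega) ih
        _ = _ := by ring
  induction y, hy using Nat.le_induction with
  | base => exact step1
  | succ y hy ih =>
    have e : u + (y + 1) - 1 = (u + y - 1) + 1 := by omega
    rw [e, Nat.factorial_succ y, Nat.factorial_succ (u + y - 1)]
    calc u ! * ((y + 1) * y !) * (A + B - 1)! = (y + 1) * (u ! * y ! * (A + B - 1)!) := by ring
      _ ≤ (u + y - 1 + 1) * ((u + y - 1)! * (A ! * B !)) :=
          Nat.mul_le_mul (by omega) ih
      _ = _ := by ring

theorem choose_mul_choose_le (a b i j : ℕ) :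
    a.choose i * b.choose j ≤ (a + b).choose (i + j) := by
  rw [Nat.add_choose_eq]
  exact Finset.single_le_sum (f := fun ij : ℕ × ℕ => a.choose ij.1 * b.choose ij.2)
    (fun _ _ => Nat.zero_le _) (by simp : (i, j) ∈ Finset.HasAntidiagonal.antidiagonal (i + j))

theorem card_mul_le_sum {ι : Type*} {s : Finset ι} {v : ι → ℕ} {c : ℕ}
    (h : ∀ x ∈ s, c ≤ v x) : c * s.card ≤ ∑ x ∈ s, v x := by
  have := Finset.card_nsmul_le_sum s v c h
  simpa [mul_comm] using this

theorem sum_powerset_le_of_le_card {ι : Type*} {T : Finset ι} {F : Finset ι → ℝ}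
    {f : ℕ → ℝ} (h : ∀ s ∈ T.powerset, F s ≤ f s.card) :
    ∑ s ∈ T.powerset, F s ≤ ∑ j ∈ Finset.range (T.card + 1), T.card.choose j • f j := by
  rw [← Finset.sum_powerset_apply_card f]
  exact Finset.sum_le_sum h

/-- The sum of `|v_s|! |v_{T ∖ s}|!` over the proper nonempty subsets `s` of `T`. -/
theorem sum_factorial_mul_factorial_sdiff_le {ι : Type*} [DecidableEq ι] (T : Finset ι)
    (v : ι → ℕ) (hv : ∀ x ∈ T, 2 ≤ v x) :
    ∑ s ∈ T.powerset, (if s = ∅ ∨ s = T then (0 : ℝ) else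
        ((∑ x ∈ s, v x)! : ℝ) * ((∑ x ∈ T \ s, v x)! : ℝ))
      ≤ 8 * ((∑ x ∈ T, v x) - 1)! := by
  set b := T.card with hb
  rcases Nat.lt_or_ge b 2 with hlt | hge
  · refine (Finset.sum_nonpos fun s hs => ?_).trans (by positivity)
    have hs' := Finset.mem_powerset.1 hs
    by_cases h : s = ∅ ∨ s = T
    · simp [h]
    · push Not at h
      have h1 := Finset.card_lt_card (hs'.ssubset_of_ne h.2)
      have h2 := Finset.card_pos.2 h.1
      omega
  have hpt : ∀ s ∈ T.powerset, (if s = ∅ ∨ s = T then (0 : ℝ) else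
        ((∑ x ∈ s, v x)! : ℝ) * ((∑ x ∈ T \ s, v x)! : ℝ)) ≤
      (fun j : ℕ => if j = 0 ∨ j = b then (0 : ℝ) else
        ((∑ x ∈ T, v x) - 1)! * (2 * b / (b.choose j : ℝ) ^ 2)) s.card := by
    intro s hs
    have hs' := Finset.mem_powerset.1 hs
    by_cases h : s = ∅ ∨ s = T
    · beta_reduce
      rw [if_pos h, if_pos]
      rcases h with rfl | rfl <;> simp [hb]
    have hcard : ¬ (s.card = 0 ∨ s.card = b) := by
      push Not at h ⊢
      exact ⟨(Finset.card_pos.2 h.1).ne',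
        (Finset.card_lt_card (hs'.ssubset_of_ne h.2)).ne⟩
    rw [if_neg h]
    simp only [hcard, if_false]
    set j := s.card with hj
    have hjb : j < b := by
      have := Finset.card_le_card hs'
      omega
    have hu : 2 * j ≤ ∑ x ∈ s, v x := card_mul_le_sum fun x hx => hv x (hs' hx)
    have hy : 2 * (b - j) ≤ ∑ x ∈ T \ s, v x := by
      have := card_mul_le_sum (s := T \ s) (v := v) (c := 2)
        fun x hx => hv x (Finset.mem_sdiff.1 hx).1
      rwa [Finset.card_sdiff_of_subset hs'] at this
    have hsum : ∑ x ∈ s, v x + ∑ x ∈ T \ s, v x = ∑ x ∈ T, v x := by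
      rw [add_comm]; exact Finset.sum_sdiff hs'
    set u := ∑ x ∈ s, v x
    set y := ∑ x ∈ T \ s, v x
    have hm := factorial_mul_factorial_antitone (A := 2 * j) (B := 2 * (b - j)) (u := u) (y := y)
      (by omega) (by omega) hu hy
    rw [hsum] at hm
    have hc : b.choose j ^ 2 ≤ (2 * b).choose (2 * j) := by
      have := choose_mul_choose_le b b j j
      rwa [← sq, ← two_mul, ← two_mul] at this
    have hfac : (2 * b).choose (2 * j) * ((2 * j)! * (2 * (b - j))!) =
        2 * b * (2 * j + 2 * (b - j) - 1)! := by
      have h1 := Nat.choose_mul_factorial_mul_factorial (n := 2 * b) (k := 2 * j) (by omega)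
      have e1 : 2 * b - 2 * j = 2 * (b - j) := by omega
      have e2 : 2 * j + 2 * (b - j) - 1 = 2 * b - 1 := by omega
      rw [e1] at h1
      rw [← mul_assoc, h1, e2, Nat.mul_factorial_pred (by omega)]
    have hcpos : 0 < b.choose j := Nat.choose_pos hjb.le
    have hcpos' : (0 : ℝ) < (b.choose j : ℝ) ^ 2 := by positivity
    rw [mul_div_assoc', le_div_iff₀ hcpos']
    have hF : 0 < (2 * j + 2 * (b - j) - 1)! := Nat.factorial_pos _
    have main : u ! * y ! * b.choose j ^ 2 ≤ (∑ x ∈ T, v x - 1)! * (2 * b) := by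
      refine Nat.le_of_mul_le_mul_right ?_ hF
      calc u ! * y ! * b.choose j ^ 2 * (2 * j + 2 * (b - j) - 1)!
          = b.choose j ^ 2 * (u ! * y ! * (2 * j + 2 * (b - j) - 1)!) := by ring
        _ ≤ (2 * b).choose (2 * j) * ((∑ x ∈ T, v x - 1)! * ((2 * j)! * (2 * (b - j))!)) :=
            Nat.mul_le_mul hc hm
        _ = (∑ x ∈ T, v x - 1)! * ((2 * b).choose (2 * j) * ((2 * j)! * (2 * (b - j))!)) := by
            ring
        _ = _ := by rw [hfac]; ring
    exact_mod_cast main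
  refine (sum_powerset_le_of_le_card (f := fun j => if j = 0 ∨ j = b then (0 : ℝ) else
        ((∑ x ∈ T, v x) - 1)! * (2 * b / (b.choose j : ℝ) ^ 2)) hpt).trans ?_
  have hrw : ∀ j ∈ Finset.range (b + 1), (b.choose j) • (if j = 0 ∨ j = b then (0 : ℝ) else
        ((∑ x ∈ T, v x) - 1)! * (2 * b / (b.choose j : ℝ) ^ 2)) =
      ((∑ x ∈ T, v x) - 1)! * (2 * b) *
        (if j = 0 ∨ j = b then (0 : ℝ) else 1 / (b.choose j : ℝ)) := by
    intro j hj
    split_ifs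
    · simp
    · have hjb : j ≤ b := by simpa [Nat.lt_succ_iff] using hj
      have : (b.choose j : ℝ) ≠ 0 := by exact_mod_cast (Nat.choose_pos hjb).ne'
      rw [nsmul_eq_mul]
      field_simp
  rw [← hb, Finset.sum_congr rfl hrw, ← Finset.mul_sum]
  have hb0 : (0 : ℝ) < b := by exact_mod_cast (by omega : 0 < b)
  calc _ ≤ (((∑ x ∈ T, v x) - 1)! : ℝ) * (2 * b) * (4 / b) :=
        mul_le_mul_of_nonneg_left (sum_inv_choose_interior_le hge) (by positivity)
    _ = _ := by field_simp; ring

theorem succ_mul_pow_le_choose {A B : ℕ} (hA : 1 ≤ A) (hAB : A ≤ 2 * B) :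
    ((B : ℝ) + 1) * (3 / 2) ^ (A - 1) ≤ ((A + B).choose A : ℝ) := by
  induction A, hA using Nat.le_induction with
  | base => simp [add_comm]
  | succ A hA ih =>
    have ih' := ih (by omega)
    have hrec : ((A + 1 + B).choose (A + 1) : ℝ) * (A + 1) =
        ((A + B).choose A : ℝ) * (A + B + 1) := by
      have := Nat.add_one_mul_choose_eq (A + B) A
      have e : A + 1 + B = A + B + 1 := by ring
      rw [e]
      have h2 : (A + B + 1).choose (A + 1) * (A + 1) = (A + B).choose A * (A + B + 1) := by
        rw [← this]; ring
      exact_mod_cast h2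
    have hA1 : (0 : ℝ) < A + 1 := by positivity
    have hB : ((A : ℝ) + 1) ≤ 2 * B := by exact_mod_cast hAB
    have e : A + 1 - 1 = (A - 1) + 1 := by omega
    rw [e, pow_succ]
    refine le_of_mul_le_mul_right ?_ hA1
    rw [hrec]
    calc ((B : ℝ) + 1) * ((3 / 2) ^ (A - 1) * (3 / 2)) * (A + 1)
        = (((B : ℝ) + 1) * (3 / 2) ^ (A - 1)) * (3 / 2 * (A + 1)) := by ring
      _ ≤ ((A + B).choose A : ℝ) * (A + B + 1) := by
        gcongr
        linarith

/-- Moving items of weight at least `2` between a box with base load `q` and a larger box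
with base load `Q`. -/
theorem sum_two_boxes_le {ι : Type*} [DecidableEq ι] (S : Finset ι) (p : ι → ℕ)
    (hp : ∀ x ∈ S, 2 ≤ p x) {q Q : ℕ} (hq : 1 ≤ q) :
    ∑ R ∈ S.powerset, (if q + ∑ x ∈ R, p x ≤ Q + ∑ x ∈ S \ R, p x then
        ((q + ∑ x ∈ R, p x)! : ℝ) * ((Q + ∑ x ∈ S \ R, p x)! : ℝ) else 0)
      ≤ 18 * (2 / 3) ^ q * (q + Q + ∑ x ∈ S, p x - 1)! := by
  set b := S.card with hb
  have hpt : ∀ R ∈ S.powerset, (if q + ∑ x ∈ R, p x ≤ Q + ∑ x ∈ S \ R, p x then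
        ((q + ∑ x ∈ R, p x)! : ℝ) * ((Q + ∑ x ∈ S \ R, p x)! : ℝ) else 0) ≤
      (fun j : ℕ => (q + Q + ∑ x ∈ S, p x - 1)! * (6 * (2 / 3) ^ (q + j) /
        (b.choose j : ℝ))) R.card := by
    intro R hR
    have hR' := Finset.mem_powerset.1 hR
    split_ifs with hle
    swap
    · positivity
    set j := R.card with hj
    have hjb : j ≤ b := Finset.card_le_card hR'
    have hu0 : 2 * j ≤ ∑ x ∈ R, p x := card_mul_le_sum fun x hx => hp x (hR' hx)
    have hy0 : 2 * (b - j) ≤ ∑ x ∈ S \ R, p x := by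
      have := card_mul_le_sum (s := S \ R) (v := p) (c := 2)
        fun x hx => hp x (Finset.mem_sdiff.1 hx).1
      rwa [Finset.card_sdiff_of_subset hR'] at this
    have hsum : ∑ x ∈ R, p x + ∑ x ∈ S \ R, p x = ∑ x ∈ S, p x := by
      rw [add_comm]; exact Finset.sum_sdiff hR'
    obtain ⟨u, hu⟩ : ∃ u, u = q + ∑ x ∈ R, p x := ⟨_, rfl⟩
    obtain ⟨y, hy⟩ : ∃ y, y = Q + ∑ x ∈ S \ R, p x := ⟨_, rfl⟩
    rw [← hu, ← hy] at hle ⊢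
    have huy : q + Q + ∑ x ∈ S, p x = u + y := by omega
    rw [huy]
    have hA : 1 ≤ u - j := by omega
    have hAB : u - j ≤ 2 * (y - (b - j)) := by omega
    have h1 := succ_mul_pow_le_choose hA hAB
    have h2 := choose_mul_choose_le b ((u - j) + (y - (b - j))) j (u - j)
    have e1 : b + ((u - j) + (y - (b - j))) = u + y := by omega
    have e2 : j + (u - j) = u := by omega
    rw [e1, e2] at h2
    have h3 : ((b.choose j : ℝ)) * (((y - (b - j) : ℕ) + 1) * (3 / 2) ^ (u - j - 1)) ≤
        ((u + y).choose u : ℝ) := by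
      refine (mul_le_mul_of_nonneg_left h1 (by positivity)).trans ?_
      exact_mod_cast h2
    have h4 : ((3 : ℝ) / 2) ^ (q + j - 1) ≤ (3 / 2) ^ (u - j - 1) :=
      pow_le_pow_right₀ (by norm_num) (by omega)
    have h5 : ((u : ℝ) + y) ≤ 4 * ((y - (b - j) : ℕ) + 1) := by
      have : u + y ≤ 4 * ((y - (b - j)) + 1) := by omega
      exact_mod_cast this
    have hfac : ((u + y).choose u : ℝ) * ((u ! : ℝ) * y !) = (u + y) * ((u + y - 1)! : ℝ) := by
      have h := Nat.choose_mul_factorial_mul_factorial (n := u + y) (k := u) (by omega)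
      rw [Nat.add_sub_cancel_left] at h
      have h' : (u + y).choose u * (u ! * y !) = (u + y) * (u + y - 1)! := by
        rw [← mul_assoc, h, Nat.mul_factorial_pred (by omega)]
      exact_mod_cast h'
    have hc : (0 : ℝ) < b.choose j := by exact_mod_cast Nat.choose_pos hjb
    beta_reduce
    rw [mul_div_assoc', le_div_iff₀ hc]
    have hpw : ((2 : ℝ) / 3) ^ (q + j) * (3 / 2) ^ (q + j - 1) = 2 / 3 := by
      have e : q + j = (q + j - 1) + 1 := by omega
      conv_lhs => rw [e]
      rw [Nat.add_sub_cancel, pow_succ, mul_right_comm, ← mul_pow]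
      norm_num
    have hbig : (0 : ℝ) < 4 * ((y - (b - j) : ℕ) + 1) * (3 / 2) ^ (q + j - 1) := by positivity
    refine le_of_mul_le_mul_right ?_ hbig
    calc (u ! : ℝ) * y ! * (b.choose j : ℝ) * (4 * ((y - (b - j) : ℕ) + 1) * (3 / 2) ^ (q + j - 1))
        = 4 * ((b.choose j : ℝ) * (((y - (b - j) : ℕ) + 1) * (3 / 2) ^ (q + j - 1)))
            * ((u ! : ℝ) * y !) := by ring
      _ ≤ 4 * ((u + y).choose u : ℝ) * ((u ! : ℝ) * y !) := by
          gcongr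
          refine le_trans ?_ h3
          gcongr
      _ = 4 * ((u + y) * ((u + y - 1)! : ℝ)) := by rw [mul_assoc, hfac]
      _ ≤ 4 * ((4 * ((y - (b - j) : ℕ) + 1)) * ((u + y - 1)! : ℝ)) := by gcongr
      _ = ((u + y - 1)! : ℝ) * (6 * (2 / 3)) * (4 * ((y - (b - j) : ℕ) + 1)) := by ring
      _ = ((u + y - 1)! : ℝ) * (6 * ((2 / 3) ^ (q + j) * (3 / 2) ^ (q + j - 1))) *
            (4 * ((y - (b - j) : ℕ) + 1)) := by rw [hpw]
      _ = _ := by ring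
  refine (sum_powerset_le_of_le_card (f := fun j => (q + Q + ∑ x ∈ S, p x - 1)! *
        (6 * (2 / 3) ^ (q + j) / (b.choose j : ℝ))) hpt).trans ?_
  have hrw : ∀ j ∈ Finset.range (b + 1), (b.choose j) • ((q + Q + ∑ x ∈ S, p x - 1)! *
        (6 * (2 / 3) ^ (q + j) / (b.choose j : ℝ))) =
      (6 * (2 / 3) ^ q * (q + Q + ∑ x ∈ S, p x - 1)! : ℝ) * (2 / 3) ^ j := by
    intro j hj
    have hjb : j ≤ b := by simpa [Nat.lt_succ_iff] using hj
    have : (b.choose j : ℝ) ≠ 0 := by exact_mod_cast (Nat.choose_pos hjb).ne'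
    rw [nsmul_eq_mul, pow_add]
    field_simp
  rw [← hb, Finset.sum_congr rfl hrw, ← Finset.mul_sum]
  have hg : ∑ j ∈ Finset.range (b + 1), ((2 : ℝ) / 3) ^ j ≤ 3 := by
    rw [geom_sum_eq (by norm_num), div_le_iff_of_neg (by norm_num)]
    have : (0 : ℝ) ≤ (2 / 3) ^ (b + 1) := by positivity
    linarith
  calc _ ≤ (6 * (2 / 3) ^ q * (q + Q + ∑ x ∈ S, p x - 1)! : ℝ) * 3 :=
        mul_le_mul_of_nonneg_left hg (by positivity)
    _ = _ := by ring

theorem sum_range_zpow_neg_le (k n : ℕ) :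
    ∑ j ∈ Finset.range (n + 1), ((j : ℝ) + 1) ^ (-((k + 2 : ℕ) : ℤ)) ≤
      1 + (1 / 2) ^ k * (1 - 1 / ((n : ℝ) + 1)) := by
  induction n with
  | zero => simp
  | succ n ih =>
    rw [Finset.sum_range_succ]
    have hstep : (((n + 1 : ℕ) : ℝ) + 1) ^ (-((k + 2 : ℕ) : ℤ)) ≤
        (1 / 2) ^ k * (1 / ((n : ℝ) + 1) - 1 / ((n : ℝ) + 2)) := by
      have e : (((n + 1 : ℕ) : ℝ) + 1) = n + 2 := by push_cast; ring
      rw [e, zpow_neg, zpow_natCast, ← inv_pow, pow_add]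
      have h1 : ((n : ℝ) + 2)⁻¹ ≤ 1 / 2 := by
        rw [one_div]
        exact inv_anti₀ (by norm_num) (by linarith [(Nat.cast_nonneg n : (0 : ℝ) ≤ n)])
      have h2 : (((n : ℝ) + 2)⁻¹) ^ 2 ≤ 1 / ((n : ℝ) + 1) - 1 / ((n : ℝ) + 2) := by
        have : 1 / ((n : ℝ) + 1) - 1 / ((n : ℝ) + 2) = 1 / (((n : ℝ) + 1) * (n + 2)) := by
          field_simp
          ring
        rw [this, inv_pow, ← one_div]
        apply one_div_le_one_div_of_le (by positivity)
        nlinarith [(Nat.cast_nonneg n : (0 : ℝ) ≤ n)]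
      gcongr
    refine (add_le_add ih hstep).trans (le_of_eq ?_)
    push_cast
    ring

theorem zetaSeries_bounds (k : ℕ) :
    1 ≤ zetaSeries ((k + 2 : ℕ) : ℤ) ∧ zetaSeries ((k + 2 : ℕ) : ℤ) ≤ 1 + (1 / 2) ^ k := by
  have hnn : ∀ j : ℕ, (0 : ℝ) ≤ ((j : ℝ) + 1) ^ (-((k + 2 : ℕ) : ℤ)) := fun j => by positivity
  have hb : ∀ n : ℕ, ∑ j ∈ Finset.range n, ((j : ℝ) + 1) ^ (-((k + 2 : ℕ) : ℤ)) ≤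
      1 + (1 / 2) ^ k := by
    intro n
    cases n with
    | zero => simp; positivity
    | succ n =>
      refine (sum_range_zpow_neg_le k n).trans ?_
      have h1 : (0 : ℝ) ≤ 1 / ((n : ℝ) + 1) := by positivity
      have h2 : (0 : ℝ) ≤ (1 / 2) ^ k := by positivity
      nlinarith
  have hs := summable_of_sum_range_le hnn hb
  refine ⟨?_, Real.tsum_le_of_sum_range_le hnn hb⟩
  have := hs.sum_le_tsum {0} (fun j _ => hnn j)
  simpa [zetaSeries] using this

theorem abs_zed_sub_two_le {k : ℕ} (hk : Even k) :
    |zed ((k + 2 : ℕ) : ℤ) - 2| ≤ (1 / 2) ^ k := by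
  obtain ⟨h1, h2⟩ := zetaSeries_bounds k
  have h0 : ((k + 2 : ℕ) : ℤ) ≠ 0 := by positivity
  have he : 2 ≤ ((k + 2 : ℕ) : ℤ) ∧ Even ((k + 2 : ℕ) : ℤ) := by
    refine ⟨by push_cast; omega, ?_⟩
    rw [Int.even_coe_nat]
    exact hk.add even_two
  have hp : (2 : ℝ) ^ (2 - ((k + 2 : ℕ) : ℤ)) = (1 / 2) ^ k := by
    have : (2 - ((k + 2 : ℕ) : ℤ)) = -(k : ℤ) := by push_cast; ring
    rw [this, zpow_neg, zpow_natCast, one_div, inv_pow]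
  rw [zed, if_neg h0, if_pos he, hp]
  have hd0 : (0 : ℝ) ≤ (1 / 2) ^ k := by positivity
  have hd1 : ((1 : ℝ) / 2) ^ k ≤ 1 := pow_le_one₀ (by norm_num) (by norm_num)
  rw [abs_le]
  constructor <;> nlinarith

theorem abs_zed_le (k : ℤ) : |zed k| ≤ 3 := by
  by_cases h0 : k = 0
  · simp [zed, h0]
  by_cases h : 2 ≤ k ∧ Even k
  · obtain ⟨j, rfl⟩ : ∃ j : ℕ, k = ((j + 2 : ℕ) : ℤ) := ⟨(k - 2).toNat, by push_cast; omega⟩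
    have he : Even j := by
      have := h.2
      rw [Int.even_coe_nat] at this
      simpa [Nat.even_add] using this
    have h1 := abs_zed_sub_two_le he
    have h2 : ((1 : ℝ) / 2) ^ j ≤ 1 := pow_le_one₀ (by norm_num) (by norm_num)
    rw [abs_le] at h1 ⊢
    constructor <;> linarith
  · simp [zed, h0, h]

theorem sum_inv_factorial_range_le (n : ℕ) :
    ∑ d ∈ Finset.range n, (1 : ℝ) / (d ! : ℝ) ≤ 3 := by
  have := Real.sum_le_exp_of_nonneg (x := 1) (by norm_num) n
  have he := Real.exp_one_lt_d9
  simp only [one_pow] at this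
  linarith

theorem sum_le_sum_of_injOn_map {α β : Type*} {A : Finset α} {B : Finset β} {F : α → ℝ}
    {G : β → ℝ} (f : α → β) (hmap : ∀ a ∈ A, f a ∈ B) (hinj : Set.InjOn f A)
    (h : ∀ a ∈ A, F a ≤ G (f a)) (hG : ∀ b ∈ B, 0 ≤ G b) :
    ∑ a ∈ A, F a ≤ ∑ b ∈ B, G b := by
  calc ∑ a ∈ A, F a ≤ ∑ a ∈ A, G (f a) := Finset.sum_le_sum h
    _ = ∑ b ∈ A.image f, G b := (Finset.sum_image hinj).symm
    _ ≤ ∑ b ∈ B, G b := Finset.sum_le_sum_of_subset_of_nonneg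
        (Finset.image_subset_iff.2 hmap) fun b hb _ => hG b hb

theorem sum_le_sum_sum_filter {α β : Type*} {A : Finset α} {B : Finset β} {F : α → ℝ}
    (R : α → β → Prop) (h : ∀ a ∈ A, ∃ b ∈ B, R a b) (hF : ∀ a ∈ A, 0 ≤ F a) :
    ∑ a ∈ A, F a ≤ ∑ b ∈ B, ∑ a ∈ A.filter (fun a => R a b), F a := by
  simp_rw [Finset.sum_filter]
  rw [Finset.sum_comm]
  refine Finset.sum_le_sum fun a ha => ?_
  obtain ⟨b, hb, hab⟩ := h a ha
  have hnn : ∀ c ∈ B, 0 ≤ (if R a c then F a else 0) := fun c _ => by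
    split_ifs
    · exact hF a ha
    · exact le_rfl
  refine le_trans ?_ (Finset.single_le_sum hnn hb)
  rw [if_pos hab]

namespace IsSetPartitionOn

variable {ι : Type*} [DecidableEq ι] {S : Finset ι} {P : Finset (Finset ι)}

theorem eq_of_mem (h : IsSetPartitionOn S P) {s t : Finset ι} {x : ι} (hs : s ∈ P) (ht : t ∈ P)
    (hxs : x ∈ s) (hxt : x ∈ t) : s = t :=
  (h.2 x ((h.1 s hs).1 hxs)).unique ⟨hs, hxs⟩ ⟨ht, hxt⟩

theorem disjoint (h : IsSetPartitionOn S P) {s t : Finset ι} (hs : s ∈ P) (ht : t ∈ P)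
    (hne : s ≠ t) : Disjoint s t :=
  Finset.disjoint_left.2 fun _ hxs hxt => hne (h.eq_of_mem hs ht hxs hxt)

theorem sum_eq (h : IsSetPartitionOn S P) {M : Type*} [AddCommMonoid M] (f : ι → M) :
    ∑ s ∈ P, ∑ x ∈ s, f x = ∑ x ∈ S, f x := by
  have hS : S = P.biUnion id := by
    ext x
    simp only [Finset.mem_biUnion, id]
    constructor
    · intro hx
      obtain ⟨s, ⟨hs, hxs⟩, -⟩ := h.2 x hx
      exact ⟨s, hs, hxs⟩
    · rintro ⟨s, hs, hxs⟩
      exact (h.1 s hs).1 hxs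
  rw [hS, Finset.sum_biUnion]
  · rfl
  · intro s hs t ht hne
    exact h.disjoint hs ht hne

theorem singleton (hS : S ≠ ∅) : IsSetPartitionOn S {S} := by
  refine ⟨fun s hs => ?_, fun x hx => ⟨S, ⟨by simp, hx⟩, fun t ht => by simpa using ht.1⟩⟩
  rw [Finset.mem_singleton] at hs
  subst hs
  exact ⟨subset_rfl, hS⟩

theorem eq_singleton (h : IsSetPartitionOn S P) (hS : S ∈ P) : P = {S} := by
  ext t
  rw [Finset.mem_singleton]
  constructor
  · intro ht
    obtain ⟨x, hx⟩ := Finset.nonempty_iff_ne_empty.2 (h.1 t ht).2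
    exact h.eq_of_mem ht hS hx ((h.1 t ht).1 hx)
  · rintro rfl
    exact hS

theorem eq_singleton_of_card_le_one (h : IsSetPartitionOn S P) (hS : S ≠ ∅) (hP : P.card ≤ 1) :
    P = {S} := by
  obtain ⟨x, hx⟩ := Finset.nonempty_iff_ne_empty.2 hS
  obtain ⟨s, ⟨hs, hxs⟩, -⟩ := h.2 x hx
  refine h.eq_singleton ?_
  have : S = s := by
    refine Finset.Subset.antisymm (fun y hy => ?_) (h.1 s hs).1
    obtain ⟨t, ⟨ht, hyt⟩, -⟩ := h.2 y hy
    rwa [Finset.card_le_one.1 hP s hs t ht]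
  rwa [this]

theorem erase (h : IsSetPartitionOn S P) {t : Finset ι} (ht : t ∈ P) :
    IsSetPartitionOn (S \ t) (P.erase t) := by
  refine ⟨fun s hs => ?_, fun x hx => ?_⟩
  · have hs' := Finset.mem_erase.1 hs
    exact ⟨fun x hx => Finset.mem_sdiff.2 ⟨(h.1 s hs'.2).1 hx,
      Finset.disjoint_left.1 (h.disjoint hs'.2 ht hs'.1) hx⟩, (h.1 s hs'.2).2⟩
  · obtain ⟨hxS, hxt⟩ := Finset.mem_sdiff.1 hx
    obtain ⟨s, ⟨hs, hxs⟩, hu⟩ := h.2 x hxS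
    refine ⟨s, ⟨Finset.mem_erase.2 ⟨?_, hs⟩, hxs⟩, fun r hr => hu r ⟨Finset.mem_of_mem_erase hr.1, hr.2⟩⟩
    rintro rfl
    exact hxt hxs

theorem notMem_of_sdiff {t : Finset ι} (h : IsSetPartitionOn (S \ t) P) (ht : t ≠ ∅) : t ∉ P := by
  intro hmem
  obtain ⟨x, hx⟩ := Finset.nonempty_iff_ne_empty.2 ht
  exact (Finset.mem_sdiff.1 ((h.1 t hmem).1 hx)).2 hx

theorem insert {t : Finset ι} (h : IsSetPartitionOn (S \ t) P) (htS : t ⊆ S) (ht : t ≠ ∅) :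
    IsSetPartitionOn S (insert t P) := by
  refine ⟨fun s hs => ?_, fun x hx => ?_⟩
  · rcases Finset.mem_insert.1 hs with rfl | hs
    · exact ⟨htS, ht⟩
    · exact ⟨(h.1 s hs).1.trans Finset.sdiff_subset, (h.1 s hs).2⟩
  · by_cases hxt : x ∈ t
    · refine ⟨t, ⟨Finset.mem_insert_self _ _, hxt⟩, fun r hr => ?_⟩
      rcases Finset.mem_insert.1 hr.1 with rfl | hrP
      · rfl
      · exact absurd hxt (Finset.mem_sdiff.1 ((h.1 r hrP).1 hr.2)).2
    · obtain ⟨s, ⟨hs, hxs⟩, hu⟩ := h.2 x (Finset.mem_sdiff.2 ⟨hx, hxt⟩)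
      refine ⟨s, ⟨Finset.mem_insert_of_mem hs, hxs⟩, fun r hr => ?_⟩
      rcases Finset.mem_insert.1 hr.1 with rfl | hrP
      · exact absurd hr.2 hxt
      · exact hu r ⟨hrP, hr.2⟩

end IsSetPartitionOn

section PartitionSum

variable {ι : Type*} [Fintype ι] [DecidableEq ι]

/-- The sum of `ℓ(P)! ∏_{s ∈ P} w s` over the set partitions `P` of `S`. -/
noncomputable def partitionSum (w : Finset ι → ℝ) (S : Finset ι) : ℝ :=
  ∑ P ∈ Finset.univ.filter (fun P : Finset (Finset ι) => IsSetPartitionOn S P),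
    (P.card ! : ℝ) * ∏ s ∈ P, w s

/-- The sum of `ℓ(P)! ∏_{s ∈ P} w s` over the set partitions `P` of `S` with `ℓ(P) ≥ 2`. -/
noncomputable def properPartitionSum (w : Finset ι → ℝ) (S : Finset ι) : ℝ :=
  ∑ P ∈ Finset.univ.filter
      (fun P : Finset (Finset ι) => IsSetPartitionOn S P ∧ 2 ≤ P.card),
    (P.card ! : ℝ) * ∏ s ∈ P, w s

theorem partitionSum_empty (w : Finset ι → ℝ) : partitionSum w ∅ = 1 := by
  have : Finset.univ.filter (fun P : Finset (Finset ι) => IsSetPartitionOn ∅ P) = {∅} := by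
    ext P
    simp only [Finset.mem_filter, Finset.mem_univ, true_and, Finset.mem_singleton]
    constructor
    · intro h
      refine Finset.eq_empty_of_forall_notMem fun s hs => (h.1 s hs).2 ?_
      exact Finset.subset_empty.1 (h.1 s hs).1
    · rintro rfl
      exact ⟨by simp, by simp⟩
  rw [partitionSum, this]
  simp

theorem partitionSum_nonneg {w : Finset ι → ℝ} (hw : ∀ s, 0 ≤ w s) (S : Finset ι) :
    0 ≤ partitionSum w S :=
  Finset.sum_nonneg fun _ _ => mul_nonneg (by positivity) (Finset.prod_nonneg fun s _ => hw s)

theorem partitionSum_eq_add (w : Finset ι → ℝ) {S : Finset ι} (hS : S ≠ ∅) :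
    partitionSum w S = w S + properPartitionSum w S := by
  have : Finset.univ.filter (fun P : Finset (Finset ι) => IsSetPartitionOn S P) =
      insert {S} (Finset.univ.filter
        (fun P : Finset (Finset ι) => IsSetPartitionOn S P ∧ 2 ≤ P.card)) := by
    ext P
    simp only [Finset.mem_filter, Finset.mem_univ, true_and, Finset.mem_insert]
    constructor
    · intro h
      rcases Nat.lt_or_ge P.card 2 with hc | hc
      · exact Or.inl (h.eq_singleton_of_card_le_one hS (by omega))
      · exact Or.inr ⟨h, hc⟩
    · rintro (rfl | h)
      · exact IsSetPartitionOn.singleton hS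
      · exact h.1
  rw [partitionSum, this, Finset.sum_insert (by simp), properPartitionSum]
  simp

theorem properPartitionSum_eq (w : Finset ι → ℝ) (S : Finset ι) :
    properPartitionSum w S =
      ∑ s ∈ S.powerset, if s = ∅ ∨ s = S then 0 else w s * partitionSum w (S \ s) := by
  have h1 : properPartitionSum w S = ∑ P ∈ Finset.univ.filter
      (fun P : Finset (Finset ι) => IsSetPartitionOn S P ∧ 2 ≤ P.card),
      ∑ t ∈ P, w t * (((P.erase t).card ! : ℝ) * ∏ s ∈ P.erase t, w s) := by
    refine Finset.sum_congr rfl fun P hP => ?_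
    have hc := (Finset.mem_filter.1 hP).2.2
    have : ∀ t ∈ P, w t * (((P.erase t).card ! : ℝ) * ∏ s ∈ P.erase t, w s) =
        ((P.card - 1)! : ℝ) * ∏ s ∈ P, w s := by
      intro t ht
      rw [Finset.card_erase_of_mem ht, ← Finset.mul_prod_erase P w ht]
      ring
    rw [Finset.sum_congr rfl this, Finset.sum_const, nsmul_eq_mul, ← mul_assoc]
    congr 1
    exact_mod_cast (Nat.mul_factorial_pred (by omega)).symm
  have h2 : ∑ s ∈ S.powerset, (if s = ∅ ∨ s = S then 0 else w s * partitionSum w (S \ s)) =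
      ∑ s ∈ S.powerset.filter (fun s => ¬ (s = ∅ ∨ s = S)),
        ∑ Q ∈ Finset.univ.filter (fun P : Finset (Finset ι) => IsSetPartitionOn (S \ s) P),
          w s * ((Q.card ! : ℝ) * ∏ r ∈ Q, w r) := by
    rw [Finset.sum_filter]
    refine Finset.sum_congr rfl fun s _ => ?_
    rw [partitionSum, Finset.mul_sum, ite_not]
  rw [h1, h2, Finset.sum_sigma', Finset.sum_sigma']
  refine Finset.sum_bij' (fun x _ => ⟨x.2, x.1.erase x.2⟩) (fun y _ => ⟨insert y.1 y.2, y.1⟩)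
    ?_ ?_ ?_ ?_ ?_
  · rintro ⟨P, t⟩ h
    simp only [Finset.mem_sigma, Finset.mem_filter, Finset.mem_univ, true_and,
      Finset.mem_powerset] at h ⊢
    obtain ⟨⟨hP, hc⟩, ht⟩ := h
    refine ⟨⟨(hP.1 t ht).1, ?_⟩, hP.erase ht⟩
    rintro (h | rfl)
    · exact (hP.1 t ht).2 h
    · rw [hP.eq_singleton ht] at hc
      simp at hc
  · rintro ⟨s, Q⟩ h
    simp only [Finset.mem_sigma, Finset.mem_filter, Finset.mem_univ, true_and,
      Finset.mem_powerset, not_or] at h ⊢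
    obtain ⟨⟨hs, hs1, hs2⟩, hQ⟩ := h
    have hi := hQ.insert hs hs1
    refine ⟨⟨hi, ?_⟩, Finset.mem_insert_self _ _⟩
    by_contra hlt
    have hS : S ≠ ∅ := fun h => hs1 (Finset.subset_empty.1 (h ▸ hs))
    have := hi.eq_singleton_of_card_le_one hS (by omega)
    have h3 : s ∈ ({S} : Finset (Finset ι)) := this ▸ Finset.mem_insert_self _ _
    exact hs2 (Finset.mem_singleton.1 h3)
  · rintro ⟨P, t⟩ h
    simp only [Finset.mem_sigma] at h
    simp [Finset.insert_erase h.2]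
  · rintro ⟨s, Q⟩ h
    simp only [Finset.mem_sigma, Finset.mem_filter, Finset.mem_univ, true_and,
      Finset.mem_powerset, not_or] at h
    simp [Finset.erase_insert (h.2.notMem_of_sdiff h.1.2.1)]
  · rintro ⟨P, t⟩ h
    rfl

theorem partitionSum_eq (w : Finset ι → ℝ) {S : Finset ι} (hS : S ≠ ∅) :
    partitionSum w S =
      ∑ s ∈ S.powerset, if s = ∅ then 0 else w s * partitionSum w (S \ s) := by
  rw [partitionSum_eq_add w hS, properPartitionSum_eq,
    ← Finset.add_sum_erase _ _ (Finset.mem_powerset_self S),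
    ← Finset.add_sum_erase _ _ (Finset.mem_powerset_self S)]
  simp only [or_true, if_true, zero_add, hS, if_false, Finset.sdiff_self, partitionSum_empty,
    mul_one]
  congr 1
  refine Finset.sum_congr rfl fun s hs => ?_
  simp [(Finset.mem_erase.1 hs).1]

end PartitionSum

theorem sum_finsuppAntidiag_prod_le {κ : Type*} [DecidableEq κ] (P : Finset κ) (k : ℕ)
    {f : ℕ → ℝ} (hf : ∀ i, 0 ≤ f i) :
    ∑ d ∈ Finset.finsuppAntidiag P k, ∏ s ∈ P, f (d s) ≤
      ∏ _s ∈ P, ∑ i ∈ Finset.range (k + 1), f i := by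
  rw [Finset.prod_sum]
  refine sum_le_sum_of_injOn_map (fun d s _ => d s) ?_ ?_ ?_ ?_
  · intro d hd
    rw [Finset.mem_finsuppAntidiag] at hd
    rw [Finset.mem_pi]
    intro s hs
    have := Finset.single_le_sum (f := fun s => d s) (fun _ _ => Nat.zero_le _) hs
    rw [Finset.mem_range]
    have h2 : ∑ s ∈ P, d s = k := hd.1
    omega
  · intro d hd d' hd' h
    have hd := (Finset.mem_finsuppAntidiag.1 hd).2
    have hd' := (Finset.mem_finsuppAntidiag.1 hd').2
    ext s
    by_cases hs : s ∈ P
    · exact congrFun (congrFun h s) hs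
    · rw [Finsupp.notMem_support_iff.1 fun h => hs (hd h),
        Finsupp.notMem_support_iff.1 fun h => hs (hd' h)]
  · intro d _
    rw [Finset.prod_attach P (fun s => f (d s))]
  · intro p _
    exact Finset.prod_nonneg fun _ _ => hf _

/-- The weight of a block `s` in the upper bounds for the brackets. -/
noncomputable def blockWeight {ι : Type*} (v : ι → ℕ) (s : Finset ι) : ℝ :=
  9 * ((∑ x ∈ s, v x)! : ℝ)

theorem blockWeight_nonneg {ι : Type*} (v : ι → ℕ) (s : Finset ι) : 0 ≤ blockWeight v s := by
  unfold blockWeight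
  positivity

section Bracket

variable {ι : Type*} [Fintype ι] [DecidableEq ι]

theorem abs_Emap_le (S : Finset ι) (v : ι → ℕ) :
    |Emap S v| ≤ properPartitionSum (blockWeight v) S := by
  refine (Finset.abs_sum_le_sum_abs _ _).trans (Finset.sum_le_sum fun P hP => ?_)
  have hc := (Finset.mem_filter.1 hP).2.2
  rw [abs_mul, abs_mul, abs_pow, abs_neg, abs_one, one_pow, one_mul, Nat.abs_cast]
  refine mul_le_mul ?_ ?_ (abs_nonneg _) (by positivity)
  · exact_mod_cast Nat.factorial_le (Nat.sub_le _ _)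
  refine (Finset.abs_sum_le_sum_abs _ _).trans ?_
  have hterm : ∀ d ∈ Finset.finsuppAntidiag P (P.card - 2),
      |∏ s ∈ P, (1 / ((d s)! : ℝ) * ((∑ x ∈ s, v x)! : ℝ) *
          zed ((∑ x ∈ s, v x : ℤ) - s.card - d s + 1))| ≤
        (∏ s ∈ P, 3 * ((∑ x ∈ s, v x)! : ℝ)) * ∏ s ∈ P, 1 / ((d s)! : ℝ) := by
    intro d _
    rw [Finset.abs_prod, ← Finset.prod_mul_distrib]
    refine Finset.prod_le_prod (fun _ _ => abs_nonneg _) fun s _ => ?_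
    rw [abs_mul, abs_of_nonneg (by positivity : (0 : ℝ) ≤ 1 / ((d s)! : ℝ) * _)]
    calc _ ≤ 1 / ((d s)! : ℝ) * ((∑ x ∈ s, v x)! : ℝ) * 3 :=
          mul_le_mul_of_nonneg_left (abs_zed_le _) (by positivity)
      _ = _ := by ring
  refine (Finset.sum_le_sum hterm).trans ?_
  rw [← Finset.mul_sum]
  have hd : ∑ d ∈ Finset.finsuppAntidiag P (P.card - 2), ∏ s ∈ P, 1 / ((d s)! : ℝ) ≤
      ∏ _s ∈ P, (3 : ℝ) :=
    (sum_finsuppAntidiag_prod_le P (P.card - 2) (f := fun i => 1 / (i ! : ℝ))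
      fun _ => by positivity).trans
      (Finset.prod_le_prod (fun _ _ => Finset.sum_nonneg fun _ _ => by positivity)
        fun _ _ => sum_inv_factorial_range_le _)
  refine (mul_le_mul_of_nonneg_left hd (Finset.prod_nonneg fun _ _ => by positivity)).trans ?_
  rw [← Finset.prod_mul_distrib]
  refine le_of_eq (Finset.prod_congr rfl fun s _ => ?_)
  rw [blockWeight]
  ring

theorem abs_innerSingle_le {S : Finset ι} (hS : S ≠ ∅) (v : ι → ℕ) :
    |innerSingle S v| ≤ partitionSum (blockWeight v) S := by
  rw [partitionSum_eq_add _ hS, innerSingle]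
  refine (abs_add_le _ _).trans (add_le_add ?_ (abs_Emap_le S v))
  rw [abs_mul, Nat.abs_cast, blockWeight]
  have h0 : (0 : ℝ) ≤ ((∑ x ∈ S, v x)! : ℝ) := by positivity
  have := mul_le_mul_of_nonneg_left (abs_zed_le ((∑ x ∈ S, v x : ℤ) - S.card + 2)) h0
  linarith

/-- The truncated exponential series controlling `partitionSum` for parts of size at least `2`. -/
noncomputable def truncExp (b : ℕ) : ℝ :=
  ∑ i ∈ Finset.range (b + 1), (36 : ℝ) ^ i / (i ! : ℝ)

theorem truncExp_mono {b c : ℕ} (h : b ≤ c) : truncExp b ≤ truncExp c :=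
  Finset.sum_le_sum_of_subset_of_nonneg (Finset.range_subset_range.2 (by omega))
    fun _ _ _ => by positivity

theorem one_le_truncExp (b : ℕ) : 1 ≤ truncExp b := by
  have := truncExp_mono (Nat.zero_le b)
  simpa [truncExp] using this

theorem truncExp_le (b : ℕ) : truncExp b ≤ Real.exp 36 :=
  Real.sum_le_exp_of_nonneg (by norm_num) _

theorem one_add_mul_truncExp_le (b : ℕ) :
    1 + 36 / ((b : ℝ) + 1) * truncExp b ≤ truncExp (b + 1) := by
  rw [truncExp, truncExp, Finset.sum_range_succ' _ (b + 1), Finset.mul_sum]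
  simp only [pow_zero, Nat.factorial_zero, Nat.cast_one, div_one]
  rw [add_comm]
  gcongr with i hi
  have hib : ((i : ℝ) + 1) ≤ b + 1 := by
    have := Finset.mem_range.1 hi
    exact_mod_cast this
  rw [Nat.factorial_succ, pow_succ]
  push_cast
  rw [_root_.div_mul_div_comm]
  have : (0 : ℝ) < (i ! : ℝ) := by positivity
  rw [mul_comm (36 : ℝ)]
  gcongr

theorem partitionSum_le_of_two_le (v : ι → ℕ) (S : Finset ι) (hv : ∀ x ∈ S, 2 ≤ v x) :
    partitionSum (blockWeight v) S ≤ 9 * truncExp S.card * ((∑ x ∈ S, v x)! : ℝ) := by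
  induction S using Finset.strongInduction with
  | H S ih =>
  rcases eq_or_ne S ∅ with rfl | hS
  · rw [partitionSum_empty]
    have := one_le_truncExp (∅ : Finset ι).card
    simp
    simp at this
    linarith
  obtain ⟨b, hb⟩ : ∃ b, S.card = b + 1 :=
    ⟨S.card - 1, by have := Finset.card_pos.2 (Finset.nonempty_iff_ne_empty.2 hS); omega⟩
  rw [partitionSum_eq_add _ hS, properPartitionSum_eq]
  have hterm : ∀ s ∈ S.powerset, (if s = ∅ ∨ s = S then 0 else
      blockWeight v s * partitionSum (blockWeight v) (S \ s)) ≤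
      81 * truncExp b * (if s = ∅ ∨ s = S then (0 : ℝ) else
        ((∑ x ∈ s, v x)! : ℝ) * ((∑ x ∈ S \ s, v x)! : ℝ)) := by
    intro s hs
    split_ifs with h
    · simp
    push Not at h
    have hs' := Finset.mem_powerset.1 hs
    have hlt : S \ s ⊂ S := Finset.sdiff_ssubset hs' h.1
    have h1 := ih (S \ s) hlt fun x hx => hv x (Finset.mem_sdiff.1 hx).1
    have h2 : truncExp (S \ s).card ≤ truncExp b := truncExp_mono (by
      have := Finset.card_lt_card hlt
      omega)
    rw [blockWeight]
    calc 9 * ((∑ x ∈ s, v x)! : ℝ) * partitionSum (blockWeight v) (S \ s)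
        ≤ 9 * ((∑ x ∈ s, v x)! : ℝ) * (9 * truncExp b * ((∑ x ∈ S \ s, v x)! : ℝ)) := by
          refine mul_le_mul_of_nonneg_left (h1.trans ?_) (by positivity)
          gcongr
      _ = _ := by ring
  have hG : 0 ≤ truncExp b := zero_le_one.trans (one_le_truncExp b)
  have hsum := (Finset.sum_le_sum hterm).trans_eq (Finset.mul_sum _ _ _).symm
  have hT := mul_le_mul_of_nonneg_left (sum_factorial_mul_factorial_sdiff_le S v hv)
    (by positivity : 0 ≤ 81 * truncExp b)
  have hV : 2 * (b + 1) ≤ ∑ x ∈ S, v x := hb ▸ card_mul_le_sum hv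
  have hfac : ((∑ x ∈ S, v x)! : ℝ) = (∑ x ∈ S, v x : ℕ) * ((∑ x ∈ S, v x - 1)! : ℝ) := by
    exact_mod_cast (Nat.mul_factorial_pred (by omega)).symm
  have hF : (0 : ℝ) ≤ ((∑ x ∈ S, v x - 1)! : ℝ) := by positivity
  have hV' : (2 : ℝ) * (b + 1) ≤ (∑ x ∈ S, v x : ℕ) := by exact_mod_cast hV
  have hstep := one_add_mul_truncExp_le b
  have hb1 : (0 : ℝ) < (b : ℝ) + 1 := by positivity
  have key : 81 * truncExp b * (8 * ((∑ x ∈ S, v x - 1)! : ℝ)) ≤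
      9 * (36 / ((b : ℝ) + 1) * truncExp b) * ((∑ x ∈ S, v x)! : ℝ) := by
    rw [hfac]
    calc 81 * truncExp b * (8 * ((∑ x ∈ S, v x - 1)! : ℝ))
        = 9 * (36 / ((b : ℝ) + 1) * truncExp b) *
            ((2 * (b + 1)) * ((∑ x ∈ S, v x - 1)! : ℝ)) := by field_simp; ring
      _ ≤ _ := by gcongr
  rw [hb]
  calc _ ≤ blockWeight v S + 9 * (36 / ((b : ℝ) + 1) * truncExp b) * ((∑ x ∈ S, v x)! : ℝ) := by
        linarith
    _ = 9 * (1 + 36 / ((b : ℝ) + 1) * truncExp b) * ((∑ x ∈ S, v x)! : ℝ) := by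
        rw [blockWeight]; ring
    _ ≤ _ := by gcongr

theorem partitionSum_insert_le (v : ι → ℕ) (S : Finset ι) (hv : ∀ x ∈ S, 1 ≤ v x) {x : ι}
    (hx : x ∉ S) (hvx : v x = 1) :
    partitionSum (blockWeight v) (insert x S) ≤
      11 * ((∑ x ∈ S, v x : ℕ) + 1) * partitionSum (blockWeight v) S := by
  induction S using Finset.strongInduction with
  | H S ih =>
  set w := blockWeight v with hw
  have hw0 : ∀ s, 0 ≤ w s := blockWeight_nonneg v
  have hpw : ∀ s ∈ S.powerset, insert x S \ insert x s = S \ s := by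
    intro s _
    ext y
    simp only [Finset.mem_sdiff, Finset.mem_insert, not_or]
    constructor
    · rintro ⟨rfl | h, h2, h3⟩
      · exact absurd rfl h2
      · exact ⟨h, h3⟩
    · rintro ⟨h, h2⟩
      exact ⟨Or.inr h, fun h' => hx (h' ▸ h), h2⟩
  have hpw' : ∀ s ∈ S.powerset, insert x S \ s = insert x (S \ s) := fun s hs =>
    Finset.insert_sdiff_of_notMem _ fun h => hx (Finset.mem_powerset.1 hs h)
  have hwi : ∀ s ∈ S.powerset, w (insert x s) = ((∑ y ∈ s, v y : ℕ) + 1) * w s := by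
    intro s hs
    rw [hw, blockWeight, blockWeight,
      Finset.sum_insert fun h => hx (Finset.mem_powerset.1 hs h), hvx, add_comm,
      Nat.factorial_succ]
    push_cast
    ring
  have hsplit : partitionSum w (insert x S) =
      ∑ s ∈ S.powerset, (if s = ∅ then 0 else w s * partitionSum w (insert x (S \ s))) +
      ∑ s ∈ S.powerset, ((∑ y ∈ s, v y : ℕ) + 1) * w s * partitionSum w (S \ s) := by
    rw [partitionSum_eq w (Finset.insert_ne_empty _ _), Finset.sum_powerset_insert hx]
    congr 1
    · exact Finset.sum_congr rfl fun s hs => by rw [hpw' s hs]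
    · refine Finset.sum_congr rfl fun s hs => ?_
      rw [if_neg (Finset.insert_ne_empty _ _), hpw s hs, hwi s hs]
  rcases eq_or_ne S ∅ with rfl | hS
  · rw [hsplit]
    simp [hw, blockWeight, partitionSum_empty]
    norm_num
  rw [hsplit]
  rw [← Finset.add_sum_erase _ (fun s => ((∑ y ∈ s, v y : ℕ) + 1) * w s * partitionSum w (S \ s))
      (Finset.empty_mem_powerset S),
    ← Finset.add_sum_erase _ (fun s => if s = ∅ then 0 else w s * partitionSum w (insert x (S \ s)))
      (Finset.empty_mem_powerset S)]
  have hrec : partitionSum w S =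
      ∑ s ∈ S.powerset.erase ∅, w s * partitionSum w (S \ s) := by
    rw [partitionSum_eq w hS, ← Finset.add_sum_erase _ _ (Finset.empty_mem_powerset S)]
    rw [if_pos rfl, zero_add]
    exact Finset.sum_congr rfl fun s hs => by rw [if_neg (Finset.mem_erase.1 hs).1]
  have hterm : ∑ s ∈ S.powerset.erase ∅,
        (if s = ∅ then 0 else w s * partitionSum w (insert x (S \ s))) +
      ∑ s ∈ S.powerset.erase ∅, ((∑ y ∈ s, v y : ℕ) + 1) * w s * partitionSum w (S \ s) ≤
      (11 * ((∑ x ∈ S, v x : ℕ) + 1) - 9) * partitionSum w S := by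
    rw [hrec, Finset.mul_sum, ← Finset.sum_add_distrib]
    refine Finset.sum_le_sum fun s hs => ?_
    obtain ⟨hs0, hs⟩ := Finset.mem_erase.1 hs
    have hs' := Finset.mem_powerset.1 hs
    rw [if_neg hs0]
    have h1 := ih (S \ s) (Finset.sdiff_ssubset hs' (Finset.nonempty_iff_ne_empty.2 hs0))
      (fun y hy => hv y (Finset.mem_sdiff.1 hy).1)
      (fun h => hx (Finset.mem_sdiff.1 h).1)
    have hsum : ∑ y ∈ s, v y + ∑ y ∈ S \ s, v y = ∑ y ∈ S, v y := by
      rw [add_comm]; exact Finset.sum_sdiff hs'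
    have hpos : 1 ≤ ∑ y ∈ s, v y := by
      have := card_mul_le_sum (s := s) (v := v) (c := 1) fun y hy => hv y (hs' hy)
      have := Finset.card_pos.2 (Finset.nonempty_iff_ne_empty.2 hs0)
      omega
    have hsum' : ((∑ y ∈ s, v y : ℕ) : ℝ) + (∑ y ∈ S \ s, v y : ℕ) = (∑ y ∈ S, v y : ℕ) := by
      exact_mod_cast hsum
    have hpos' : (1 : ℝ) ≤ (∑ y ∈ s, v y : ℕ) := by exact_mod_cast hpos
    have hA : 0 ≤ w s * partitionSum w (S \ s) := mul_nonneg (hw0 s) (partitionSum_nonneg hw0 _)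
    have h2 := mul_le_mul_of_nonneg_left h1 (hw0 s)
    have h3 : 0 ≤ (10 * ((∑ y ∈ s, v y : ℕ) : ℝ) - 10) * (w s * partitionSum w (S \ s)) :=
      mul_nonneg (by linarith) hA
    rw [← hsum']
    nlinarith
  have h0 : w ∅ = 9 := by simp [hw, blockWeight]
  simp only [if_true, zero_add, Finset.sum_empty, Nat.cast_zero, one_mul, h0, Finset.sdiff_empty]
  linarith

theorem partitionSum_blockWeight_le (v : ι → ℕ) (S : Finset ι) (hv : ∀ x ∈ S, 1 ≤ v x) :
    partitionSum (blockWeight v) S ≤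
      9 * Real.exp 36 * 11 ^ (S.filter fun x => v x = 1).card * ((∑ x ∈ S, v x)! : ℝ) := by
  induction S using Finset.strongInduction with
  | H S ih =>
  by_cases h : ∃ x ∈ S, v x = 1
  · obtain ⟨x, hx, hvx⟩ := h
    have h1 := ih (S.erase x) (Finset.erase_ssubset hx) fun y hy => hv y (Finset.mem_of_mem_erase hy)
    have h2 := partitionSum_insert_le v (S.erase x)
      (fun y hy => hv y (Finset.mem_of_mem_erase hy)) (Finset.notMem_erase x S) hvx
    rw [Finset.insert_erase hx] at h2
    have hc : (S.filter fun x => v x = 1).card = ((S.erase x).filter fun x => v x = 1).card + 1 := by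
      rw [Finset.filter_erase, Finset.card_erase_add_one]
      simp [hx, hvx]
    have hs : ∑ y ∈ S, v y = ∑ y ∈ S.erase x, v y + 1 := by
      rw [← Finset.add_sum_erase _ _ hx, hvx, add_comm]
    rw [hc, hs, Nat.factorial_succ, pow_succ]
    refine h2.trans ((mul_le_mul_of_nonneg_left h1 (by positivity)).trans (le_of_eq ?_))
    push_cast
    ring
  · push Not at h
    have h2 : ∀ x ∈ S, 2 ≤ v x := fun x hx => by
      have := hv x hx
      have := h x hx
      omega
    have hc : (S.filter fun x => v x = 1) = ∅ := Finset.filter_eq_empty_iff.2 fun {x} hx => h x hx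
    rw [hc, Finset.card_empty, pow_zero, mul_one]
    refine (partitionSum_le_of_two_le v S h2).trans ?_
    gcongr
    exact truncExp_le _

theorem abs_Emap_le_of_two_le (v : ι → ℕ) (S : Finset ι) (hv : ∀ x ∈ S, 2 ≤ v x) :
    |Emap S v| ≤ 648 * Real.exp 36 * ((∑ x ∈ S, v x - 1)! : ℝ) := by
  refine (abs_Emap_le S v).trans ?_
  rw [properPartitionSum_eq]
  have hterm : ∀ s ∈ S.powerset, (if s = ∅ ∨ s = S then 0 else
      blockWeight v s * partitionSum (blockWeight v) (S \ s)) ≤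
      81 * Real.exp 36 * (if s = ∅ ∨ s = S then (0 : ℝ) else
        ((∑ x ∈ s, v x)! : ℝ) * ((∑ x ∈ S \ s, v x)! : ℝ)) := by
    intro s _
    split_ifs with h
    · simp
    have h1 := partitionSum_le_of_two_le v (S \ s) fun x hx => hv x (Finset.mem_sdiff.1 hx).1
    have h2 := truncExp_le (S \ s).card
    rw [blockWeight]
    calc 9 * ((∑ x ∈ s, v x)! : ℝ) * partitionSum (blockWeight v) (S \ s)
        ≤ 9 * ((∑ x ∈ s, v x)! : ℝ) * (9 * Real.exp 36 * ((∑ x ∈ S \ s, v x)! : ℝ)) := by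
          refine mul_le_mul_of_nonneg_left (h1.trans ?_) (by positivity)
          gcongr
      _ = _ := by ring
  refine ((Finset.sum_le_sum hterm).trans_eq (Finset.mul_sum _ _ _).symm).trans ?_
  refine (mul_le_mul_of_nonneg_left (sum_factorial_mul_factorial_sdiff_le S v hv)
    (by positivity)).trans (le_of_eq ?_)
  ring

end Bracket

/-- A spanning tree of a connected bipartite multigraph with edge set `ι` and vertex sets `J`
and `K`, rooted at `k₀`: every vertex other than the root is assigned an edge through it, and
edges assigned to different sides are distinct. -/
theorem exists_bipartite_spanning_tree {ι J K : Type*} [Fintype J] [Fintype K] (o : ι → J)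
    (a : ι → K) (ho : Function.Surjective o) (ha : Function.Surjective a) (k₀ : K)
    (hconn : ∀ U : Set ι, (∀ x y, o x = o y → x ∈ U → y ∈ U) →
      (∀ x y, a x = a y → x ∈ U → y ∈ U) → U.Nonempty → U = Set.univ) :
    ∃ (g : K → ι) (h : J → ι), (∀ k, k ≠ k₀ → a (g k) = k) ∧ (∀ j, o (h j) = j) ∧
      ∀ k j, k ≠ k₀ → g k ≠ h j := by
  let Inv : Finset J × Finset K → (K → ι) → (J → ι) → Prop := fun AB g h =>
    k₀ ∈ AB.2 ∧ (∀ k ∈ AB.2, k ≠ k₀ → a (g k) = k ∧ o (g k) ∈ AB.1) ∧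
      (∀ j ∈ AB.1, o (h j) = j ∧ a (h j) ∈ AB.2) ∧
      ∀ k ∈ AB.2, ∀ j ∈ AB.1, k ≠ k₀ → g k ≠ h j
  obtain ⟨x₀, hx₀⟩ := ha k₀
  obtain ⟨AB, hAB, hmax⟩ := Finset.exists_max_image
    (Finset.univ.filter fun AB : Finset J × Finset K => ∃ g h, Inv AB g h)
    (fun AB => AB.1.card + AB.2.card)
    ⟨(∅, {k₀}), by
      rw [Finset.mem_filter]
      refine ⟨Finset.mem_univ _, fun _ => x₀, fun _ => x₀, by simp, ?_, by simp, by simp⟩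
      intro k hk hne
      exact absurd (Finset.mem_singleton.1 hk) hne⟩
  obtain ⟨A, B⟩ := AB
  obtain ⟨g, h, hk₀, hg, hh, hgh⟩ := (Finset.mem_filter.1 hAB).2
  have hbal : ∀ x, o x ∈ A ↔ a x ∈ B := by
    intro x
    constructor
    · intro hoA
      by_contra haB
      have : Inv (A, insert (a x) B) (Function.update g (a x) x) h := by
        refine ⟨Finset.mem_insert_of_mem hk₀, ?_, ?_, ?_⟩
        · intro k hk hne
          by_cases hkx : k = a x
          · subst hkx
            rw [Function.update_self]
            exact ⟨rfl, hoA⟩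
          · rw [Function.update_of_ne hkx]
            exact hg k ((Finset.mem_insert.1 hk).resolve_left hkx) hne
        · intro j hj
          exact ⟨(hh j hj).1, Finset.mem_insert_of_mem (hh j hj).2⟩
        · intro k hk j hj hne
          by_cases hkx : k = a x
          · subst hkx
            rw [Function.update_self]
            rintro rfl
            exact haB (hh j hj).2
          · rw [Function.update_of_ne hkx]
            exact hgh k ((Finset.mem_insert.1 hk).resolve_left hkx) j hj hne
      have hle := hmax (A, insert (a x) B) (by
        rw [Finset.mem_filter]
        exact ⟨Finset.mem_univ _, _, _, this⟩)
      simp only [Finset.card_insert_of_notMem haB] at hle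
      omega
    · intro haB
      by_contra hoA
      have : Inv (insert (o x) A, B) g (Function.update h (o x) x) := by
        refine ⟨hk₀, ?_, ?_, ?_⟩
        · intro k hk hne
          exact ⟨(hg k hk hne).1, Finset.mem_insert_of_mem (hg k hk hne).2⟩
        · intro j hj
          by_cases hjx : j = o x
          · subst hjx
            rw [Function.update_self]
            exact ⟨rfl, haB⟩
          · rw [Function.update_of_ne hjx]
            exact hh j ((Finset.mem_insert.1 hj).resolve_left hjx)
        · intro k hk j hj hne
          by_cases hjx : j = o x
          · subst hjx
            rw [Function.update_self]
            rintro rfl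
            exact hoA (hg k hk hne).2
          · rw [Function.update_of_ne hjx]
            exact hgh k hk j ((Finset.mem_insert.1 hj).resolve_left hjx) hne
      have hle := hmax (insert (o x) A, B) (by
        rw [Finset.mem_filter]
        exact ⟨Finset.mem_univ _, _, _, this⟩)
      simp only [Finset.card_insert_of_notMem hoA] at hle
      omega
  have hU := hconn {x | o x ∈ A} (fun x y hxy hx => by
      rw [Set.mem_ofPred_eq] at hx ⊢
      rwa [← hxy]) (fun x y hxy hx => by
      rw [Set.mem_ofPred_eq, hbal] at hx ⊢
      rwa [← hxy]) ⟨x₀, (hbal x₀).2 (hx₀.symm ▸ hk₀)⟩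
  have hA : ∀ j, j ∈ A := fun j => by
    obtain ⟨x, rfl⟩ := ho j
    exact (hU.symm ▸ Set.mem_univ x : x ∈ {x | o x ∈ A})
  have hB : ∀ k, k ∈ B := fun k => by
    obtain ⟨x, rfl⟩ := ha k
    exact (hbal x).1 (hA _)
  exact ⟨g, h, fun k hk => (hg k (hB k) hk).1, fun j => (hh j (hA j)).1,
    fun k j hk => hgh k (hB k) j (hA j) hk⟩

/-- The partition of `ι` into the fibers of `o`. -/
noncomputable def fiberPartition {ι J : Type*} [Fintype ι] [Fintype J] (o : ι → J) :
    Finset (Finset ι) :=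
  Finset.univ.image fun j : J => Finset.univ.filter fun x : ι => o x = j

theorem card_fiberPartition {ι J : Type*} [Fintype ι] [Fintype J] {o : ι → J}
    (ho : Function.Surjective o) : (fiberPartition o).card = Fintype.card J := by
  rw [fiberPartition, Finset.card_image_of_injective, Finset.card_univ]
  intro j j' h
  obtain ⟨x, rfl⟩ := ho j
  have : x ∈ Finset.univ.filter fun y : ι => o y = j' := by
    have hx : x ∈ Finset.univ.filter fun y : ι => o y = o x := by simp
    exact (show (Finset.univ.filter fun y : ι => o y = o x) =
      Finset.univ.filter fun y : ι => o y = j' from h) ▸ hx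
  exact (Finset.mem_filter.1 this).2

theorem IsComplementary.eq_univ_of_saturated {ι J : Type*} [Fintype ι] [DecidableEq ι]
    [Fintype J] {o : ι → J} (ho : Function.Surjective o) {α : Finset (Finset ι)}
    (hα : IsSetPartitionOn Finset.univ α) (hc : IsComplementary (fiberPartition o) α)
    {U : Finset ι} (hUo : ∀ x y, o x = o y → x ∈ U → y ∈ U)
    (hUα : ∀ s ∈ α, ∀ x ∈ s, ∀ y ∈ s, x ∈ U → y ∈ U) (hU : U.Nonempty) : U = Finset.univ := by
  by_contra hne
  have hU' : Uᶜ ≠ ∅ := by simpa using hne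
  have hdis : ∀ x, x ∈ U → x ∉ Uᶜ := fun x hx => by simpa using hx
  have hγ : IsSetPartitionOn Finset.univ ({U, Uᶜ} : Finset (Finset ι)) := by
    refine ⟨fun s hs => ⟨Finset.subset_univ _, ?_⟩, fun x _ => ?_⟩
    · rcases Finset.mem_insert.1 hs with rfl | hs
      · exact hU.ne_empty
      · rw [Finset.mem_singleton.1 hs]
        exact hU'
    · by_cases hx : x ∈ U
      · refine ⟨U, ⟨by simp, hx⟩, fun t ht => ?_⟩
        rcases Finset.mem_insert.1 ht.1 with rfl | h
        · rfl
        · rw [Finset.mem_singleton.1 h] at ht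
          exact absurd ht.2 (hdis x hx)
      · refine ⟨Uᶜ, ⟨by simp, by simpa using hx⟩, fun t ht => ?_⟩
        rcases Finset.mem_insert.1 ht.1 with rfl | h
        · exact absurd ht.2 hx
        · exact Finset.mem_singleton.1 h
  have hρ : Refines (fiberPartition o) ({U, Uᶜ} : Finset (Finset ι)) := by
    intro s hs
    simp only [fiberPartition, Finset.mem_image, Finset.mem_univ, true_and] at hs
    obtain ⟨j, rfl⟩ := hs
    obtain ⟨x, rfl⟩ := ho j
    by_cases hx : x ∈ U
    · refine ⟨U, by simp, fun y hy => hUo x y (Finset.mem_filter.1 hy).2.symm hx⟩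
    · refine ⟨Uᶜ, by simp, fun y hy => ?_⟩
      rw [Finset.mem_compl]
      exact fun h => hx (hUo y x (Finset.mem_filter.1 hy).2 h)
  have hαr : Refines α ({U, Uᶜ} : Finset (Finset ι)) := by
    intro s hs
    obtain ⟨x, hxs⟩ := Finset.nonempty_iff_ne_empty.2 (hα.1 s hs).2
    by_cases hx : x ∈ U
    · exact ⟨U, by simp, fun y hy => hUα s hs x hxs y hy hx⟩
    · refine ⟨Uᶜ, by simp, fun y hy => ?_⟩
      rw [Finset.mem_compl]
      exact fun h => hx (hUα s hs y hy x hxs h)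
  have := hc.2 _ hγ hρ hαr
  have hmem : U ∈ ({Finset.univ} : Finset (Finset ι)) := this ▸ Finset.mem_insert_self _ _
  exact hne (Finset.mem_singleton.1 hmem)

/-- For a set partition complementary to the partition into fibers of `o` there is a section `h`
of `o` whose complement meets a prescribed block in no point and every other block in exactly
one point. -/
theorem IsComplementary.exists_section {ι J : Type*} [Fintype ι] [DecidableEq ι]
    [Fintype J] {o : ι → J} (ho : Function.Surjective o) {α : Finset (Finset ι)}
    (hα : IsSetPartitionOn Finset.univ α) (hc : IsComplementary (fiberPartition o) α)
    {s₀ : Finset ι} (hs₀ : s₀ ∈ α) :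
    ∃ h : J → ι, (∀ j, o (h j) = j) ∧ s₀ ⊆ Finset.univ.image h ∧
      ∀ s ∈ α, s ≠ s₀ → (s ∩ (Finset.univ.image h)ᶜ).card = 1 := by
  choose b hb hbu using fun x => hα.2 x (Finset.mem_univ x)
  let a : ι → {s // s ∈ α} := fun x => ⟨b x, (hb x).1⟩
  have hbeq : ∀ s ∈ α, ∀ x ∈ s, b x = s := fun s hs x hx => (hbu x s ⟨hs, hx⟩).symm
  have ha : Function.Surjective a := by
    rintro ⟨s, hs⟩
    obtain ⟨x, hxs⟩ := Finset.nonempty_iff_ne_empty.2 (hα.1 s hs).2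
    exact ⟨x, Subtype.ext (hbeq s hs x hxs)⟩
  obtain ⟨g, h, hg, hh, hgh⟩ := exists_bipartite_spanning_tree o a ho ha ⟨s₀, hs₀⟩ (by
    intro U hUo hUa hU
    have := hc.eq_univ_of_saturated ho hα (U := Finset.univ.filter (· ∈ U))
      (fun x y hxy hx => by simpa using hUo x y hxy (by simpa using hx))
      (fun s hs x hx y hy hxU => by
        have hxy : a x = a y := Subtype.ext ((hbeq s hs x hx).trans (hbeq s hs y hy).symm)
        simpa using hUa x y hxy (by simpa using hxU))
      (by
        obtain ⟨x, hx⟩ := hU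
        exact ⟨x, by simpa using hx⟩)
    ext x
    have hx := Finset.mem_univ x
    rw [← this] at hx
    simpa using hx)
  set X := (Finset.univ.image h)ᶜ with hX
  have hinj : Function.Injective h := fun i j hij => by rw [← hh i, hij, hh j]
  have hcard : X.card + Fintype.card J = Fintype.card ι := by
    rw [hX, Finset.card_compl, Finset.card_image_of_injective _ hinj, Finset.card_univ]
    have := Fintype.card_le_of_injective h hinj
    omega
  have hcount : ∑ s ∈ α, (s ∩ X).card = X.card := by
    have := hα.sum_eq (fun x => if x ∈ X then 1 else 0)
    simpa [Finset.sum_ite_mem] using this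
  have hone : ∀ s ∈ α.erase s₀, 1 ≤ (s ∩ X).card := by
    intro s hs
    obtain ⟨hne, hs⟩ := Finset.mem_erase.1 hs
    have hne' : (⟨s, hs⟩ : {s // s ∈ α}) ≠ ⟨s₀, hs₀⟩ := fun h => hne (congrArg Subtype.val h)
    refine Finset.card_pos.2 ⟨g ⟨s, hs⟩, Finset.mem_inter.2 ⟨?_, ?_⟩⟩
    · have h1 : b (g ⟨s, hs⟩) = s := congrArg Subtype.val (hg _ hne')
      have h2 := (hb (g ⟨s, hs⟩)).2
      rwa [h1] at h2
    · rw [hX, Finset.mem_compl, Finset.mem_image]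
      rintro ⟨j, -, hj⟩
      exact hgh _ j hne' hj.symm
  have h1 := hc.1
  rw [card_fiberPartition ho] at h1
  rw [← Finset.add_sum_erase _ _ hs₀] at hcount
  have hec : (α.erase s₀).card + 1 = α.card := Finset.card_erase_add_one hs₀
  have hlow : (α.erase s₀).card ≤ ∑ s ∈ α.erase s₀, (s ∩ X).card := by
    have := card_mul_le_sum hone
    omega
  refine ⟨h, hh, ?_, ?_⟩
  · have h0 : (s₀ ∩ X).card = 0 := by omega
    intro x hx
    by_contra hxn
    have : x ∈ s₀ ∩ X := Finset.mem_inter.2 ⟨hx, Finset.mem_compl.2 hxn⟩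
    rw [Finset.card_eq_zero.1 h0] at this
    exact Finset.notMem_empty _ this
  · intro s hs hne
    have hs' := Finset.mem_erase.2 ⟨hne, hs⟩
    rw [← Finset.add_sum_erase _ _ hs'] at hcount
    have hec2 : ((α.erase s₀).erase s).card + 1 = (α.erase s₀).card :=
      Finset.card_erase_add_one hs'
    have hlow2 : ((α.erase s₀).erase s).card ≤ ∑ t ∈ (α.erase s₀).erase s, (t ∩ X).card := by
      have := card_mul_le_sum (s := (α.erase s₀).erase s) (v := fun t => (t ∩ X).card) (c := 1)
        fun t ht => hone t (Finset.mem_of_mem_erase ht)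
      omega
    have := hone s hs'
    change (s ∩ X).card = 1
    omega

/-- A family `Q` of disjoint subsets of `U ∪ X`, each containing exactly one point of `X` and
jointly covering `X`, such that no member of `Q` is heavier than the uncovered part. -/
structure IsRootedFamily {ι : Type*} [DecidableEq ι] (v : ι → ℕ) (X U : Finset ι)
    (Q : Finset (Finset ι)) : Prop where
  subset : ∀ s ∈ Q, s ⊆ U ∪ X
  card_inter : ∀ s ∈ Q, (s ∩ X).card = 1
  cover : ∀ e ∈ X, ∃ s ∈ Q, e ∈ s
  disjoint : ∀ s ∈ Q, ∀ t ∈ Q, s ≠ t → Disjoint s t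
  le : ∀ s ∈ Q, ∑ x ∈ s, v x + ∑ t ∈ Q, ∑ x ∈ t, v x ≤ ∑ x ∈ U, v x + ∑ x ∈ X, v x

namespace IsRootedFamily

variable {ι : Type*} [DecidableEq ι] {v : ι → ℕ} {X U R : Finset ι} {Q : Finset (Finset ι)} {e : ι}

theorem card_le (hQ : IsRootedFamily v X U Q) (hv : ∀ x ∈ U ∪ X, 1 ≤ v x) :
    X.card ≤ ∑ t ∈ Q, ∑ x ∈ t, v x := by
  have h1 : X ⊆ Q.biUnion id := fun f hf => by
    obtain ⟨s, hs, hfs⟩ := hQ.cover f hf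
    exact Finset.mem_biUnion.2 ⟨s, hs, hfs⟩
  refine (Finset.card_le_card h1).trans (Finset.card_biUnion_le.trans ?_)
  refine Finset.sum_le_sum fun t ht => ?_
  have := card_mul_le_sum (s := t) (v := v) (c := 1) fun x hx => hv x (hQ.subset t ht hx)
  simpa using this

theorem exists_eq_insert (hQ : IsRootedFamily v (insert e X) U Q) :
    ∃ R ⊆ U, insert e R ∈ Q := by
  obtain ⟨s, hs, hes⟩ := hQ.cover e (Finset.mem_insert_self _ _)
  refine ⟨s.erase e, fun x hx => ?_, by rwa [Finset.insert_erase hes]⟩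
  obtain ⟨hne, hxs⟩ := Finset.mem_erase.1 hx
  refine (Finset.mem_union.1 (hQ.subset s hs hxs)).resolve_right fun hxX => hne ?_
  exact Finset.card_le_one.1 (hQ.card_inter s hs).le x (Finset.mem_inter.2 ⟨hxs, hxX⟩) e
    (Finset.mem_inter.2 ⟨hes, Finset.mem_insert_self _ _⟩)

theorem sum_eq_erase (hs : insert e R ∈ Q) (heR : e ∉ R) :
    ∑ t ∈ Q, ∑ x ∈ t, v x =
      v e + ∑ x ∈ R, v x + ∑ t ∈ Q.erase (insert e R), ∑ x ∈ t, v x := by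
  rw [← Finset.add_sum_erase _ _ hs, Finset.sum_insert heR]

theorem erase (hQ : IsRootedFamily v (insert e X) U Q) (he : e ∉ X) (heU : e ∉ U)
    (hUX : Disjoint U X) (hR : R ⊆ U) (hs : insert e R ∈ Q) :
    IsRootedFamily v X (U \ R) (Q.erase (insert e R)) := by
  have heR : e ∉ R := fun h => heU (hR h)
  have hdis : ∀ t ∈ Q.erase (insert e R), Disjoint t (insert e R) := fun t ht =>
    hQ.disjoint t (Finset.mem_of_mem_erase ht) _ hs (Finset.mem_erase.1 ht).1
  have hte : ∀ t ∈ Q.erase (insert e R), e ∉ t := fun t ht h =>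
    Finset.disjoint_left.1 (hdis t ht) h (Finset.mem_insert_self _ _)
  refine ⟨?_, ?_, ?_, ?_, ?_⟩
  · intro t ht x hx
    have h1 := hQ.subset t (Finset.mem_of_mem_erase ht) hx
    have h2 := Finset.disjoint_left.1 (hdis t ht) hx
    simp only [Finset.mem_union, Finset.mem_insert, Finset.mem_sdiff, not_or] at h1 h2 ⊢
    tauto
  · intro t ht
    rw [← hQ.card_inter t (Finset.mem_of_mem_erase ht), Finset.inter_insert_of_notMem (hte t ht)]
  · intro f hf
    obtain ⟨t, ht, hft⟩ := hQ.cover f (Finset.mem_insert_of_mem hf)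
    refine ⟨t, Finset.mem_erase.2 ⟨?_, ht⟩, hft⟩
    rintro rfl
    rcases Finset.mem_insert.1 hft with rfl | h
    · exact he hf
    · exact Finset.disjoint_left.1 hUX (hR h) hf
  · intro s hs t ht
    exact hQ.disjoint s (Finset.mem_of_mem_erase hs) t (Finset.mem_of_mem_erase ht)
  · intro t ht
    have h1 := hQ.le t (Finset.mem_of_mem_erase ht)
    rw [sum_eq_erase hs heR, Finset.sum_insert he] at h1
    have h2 := Finset.sum_sdiff (f := v) hR
    omega

theorem sum_le (hv : ∀ x ∈ U ∪ X, 1 ≤ v x) (hUX : Disjoint U X)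
    (F : Finset (Finset (Finset ι))) (hF : ∀ Q ∈ F, IsRootedFamily v X U Q) :
    ∑ Q ∈ F, ((∑ x ∈ U, v x + ∑ x ∈ X, v x - ∑ t ∈ Q, ∑ x ∈ t, v x)! : ℝ) *
        ∏ t ∈ Q, ((∑ x ∈ t, v x)! : ℝ) ≤
      18 ^ X.card * (∏ x ∈ X, (2 / 3 : ℝ) ^ v x) *
        ((X.card : ℝ) + 1) ^ (U.filter fun x => v x = 1).card *
        ((∑ x ∈ U, v x + ∑ x ∈ X, v x - X.card)! : ℝ) := by
  induction X using Finset.induction_on generalizing U F with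
  | empty =>
    have hsub : F ⊆ {∅} := fun Q hQ => by
      rw [Finset.mem_singleton]
      refine Finset.eq_empty_of_forall_notMem fun s hs => ?_
      have := (hF Q hQ).card_inter s hs
      simp at this
    refine (Finset.sum_le_sum_of_subset_of_nonneg hsub fun _ _ _ => by positivity).trans ?_
    simp
  | insert e X he ih =>
    have heU : e ∉ U := fun h => Finset.disjoint_left.1 hUX h (Finset.mem_insert_self _ _)
    have hUX' : Disjoint U X := hUX.mono_right (Finset.subset_insert _ _)
    set U₁ := U.filter fun x => v x = 1 with hU₁
    set U₂ := U.filter fun x => ¬ v x = 1 with hU₂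
    have hcardX : X.card ≤ ∑ x ∈ X, v x := by
      have := card_mul_le_sum (s := X) (v := v) (c := 1) fun x hx =>
        hv x (Finset.mem_union_right _ (Finset.mem_insert_of_mem hx))
      simpa using this
    have hsumU : ∑ x ∈ U₁, v x + ∑ x ∈ U₂, v x = ∑ x ∈ U, v x :=
      Finset.sum_filter_add_sum_filter_not _ _ _
    have hve : 1 ≤ v e := hv e (Finset.mem_union_right _ (Finset.mem_insert_self _ _))
    have hU2 : ∀ x ∈ U₂, 2 ≤ v x := fun x hx => by
      have h1 := Finset.mem_filter.1 hx
      have := hv x (Finset.mem_union_left _ h1.1)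
      omega
    set C : ℝ := 18 ^ X.card * ∏ x ∈ X, (2 / 3 : ℝ) ^ v x with hC
    have hC0 : 0 ≤ C := by positivity
    have hpair : ∀ R₁ ∈ U₁.powerset, ∀ R₂ ∈ U₂.powerset,
        ∑ Q ∈ F.filter (fun Q => insert e (R₁ ∪ R₂) ∈ Q),
          ((∑ x ∈ U, v x + ∑ x ∈ insert e X, v x - ∑ t ∈ Q, ∑ x ∈ t, v x)! : ℝ) *
            ∏ t ∈ Q, ((∑ x ∈ t, v x)! : ℝ) ≤
        C * ((X.card : ℝ) + 1) ^ (U₁.card - R₁.card) *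
          (if (v e + ∑ x ∈ R₁, v x) + ∑ x ∈ R₂, v x ≤
              (∑ x ∈ U₁ \ R₁, v x + (∑ x ∈ X, v x - X.card)) + ∑ x ∈ U₂ \ R₂, v x then
            (((v e + ∑ x ∈ R₁, v x) + ∑ x ∈ R₂, v x)! : ℝ) *
              (((∑ x ∈ U₁ \ R₁, v x + (∑ x ∈ X, v x - X.card)) + ∑ x ∈ U₂ \ R₂, v x)! : ℝ)
          else 0) := by
      intro R₁ hR₁ R₂ hR₂
      rw [Finset.mem_powerset] at hR₁ hR₂
      set R := R₁ ∪ R₂ with hRdef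
      have hR : R ⊆ U := Finset.union_subset (hR₁.trans (Finset.filter_subset _ _))
        (hR₂.trans (Finset.filter_subset _ _))
      have heR : e ∉ R := fun h => heU (hR h)
      have hdis : Disjoint R₁ R₂ :=
        (Finset.disjoint_filter_filter_not U U _).mono hR₁ hR₂
      have hsR : ∑ x ∈ R, v x = ∑ x ∈ R₁, v x + ∑ x ∈ R₂, v x := Finset.sum_union hdis
      have hs1 := Finset.sum_sdiff (f := v) hR₁
      have hs2 := Finset.sum_sdiff (f := v) hR₂
      have hsU := Finset.sum_sdiff (f := v) hR
      have hones : ((U \ R).filter fun x => v x = 1).card = U₁.card - R₁.card := by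
        rw [← Finset.card_sdiff_of_subset hR₁]
        congr 1
        ext x
        have h2 : x ∈ R₂ → ¬ v x = 1 := fun h => (Finset.mem_filter.1 (hR₂ h)).2
        simp only [Finset.mem_filter, Finset.mem_sdiff, hU₁, hRdef, Finset.mem_union]
        tauto
      rcases Finset.eq_empty_or_nonempty (F.filter fun Q => insert e R ∈ Q) with hemp | ⟨Q₀, hQ₀⟩
      · rw [hemp, Finset.sum_empty]
        refine mul_nonneg (by positivity) ?_
        split_ifs
        · positivity
        · exact le_rfl
      have hcond : (v e + ∑ x ∈ R₁, v x) + ∑ x ∈ R₂, v x ≤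
          (∑ x ∈ U₁ \ R₁, v x + (∑ x ∈ X, v x - X.card)) + ∑ x ∈ U₂ \ R₂, v x := by
        obtain ⟨hQF, hmem⟩ := Finset.mem_filter.1 hQ₀
        have hg := hF Q₀ hQF
        have h1 := hg.le _ hmem
        have h2 := (hg.erase he heU hUX' hR hmem).card_le fun x hx => by
          refine hv x ?_
          simp only [Finset.mem_union, Finset.mem_sdiff, Finset.mem_insert] at hx ⊢
          tauto
        rw [sum_eq_erase hmem heR, Finset.sum_insert heR, Finset.sum_insert he] at h1
        omega
      rw [if_pos hcond]
      have hih := ih (U := U \ R) (fun x hx => hv x (by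
          simp only [Finset.mem_union, Finset.mem_sdiff, Finset.mem_insert] at hx ⊢
          tauto)) (hUX'.mono_left Finset.sdiff_subset)
        ((F.filter fun Q => insert e R ∈ Q).image fun Q => Q.erase (insert e R)) (by
          intro Q' hQ'
          obtain ⟨Q, hQ, rfl⟩ := Finset.mem_image.1 hQ'
          obtain ⟨hQF, hmem⟩ := Finset.mem_filter.1 hQ
          exact (hF Q hQF).erase he heU hUX' hR hmem)
      rw [Finset.sum_image (by
        intro Q hQ Q' hQ' h
        have h1 := (Finset.mem_filter.1 hQ).2
        have h2 := (Finset.mem_filter.1 hQ').2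
        rw [← Finset.insert_erase h1, ← Finset.insert_erase h2]
        exact congrArg _ h), hones] at hih
      have hterm : ∀ Q ∈ F.filter (fun Q => insert e R ∈ Q),
          ((∑ x ∈ U, v x + ∑ x ∈ insert e X, v x - ∑ t ∈ Q, ∑ x ∈ t, v x)! : ℝ) *
            ∏ t ∈ Q, ((∑ x ∈ t, v x)! : ℝ) =
          (((v e + ∑ x ∈ R₁, v x) + ∑ x ∈ R₂, v x)! : ℝ) *
          (((∑ x ∈ U \ R, v x + ∑ x ∈ X, v x -
              ∑ t ∈ Q.erase (insert e R), ∑ x ∈ t, v x)! : ℝ) *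
            ∏ t ∈ Q.erase (insert e R), ((∑ x ∈ t, v x)! : ℝ)) := by
        intro Q hQ
        have hmem := (Finset.mem_filter.1 hQ).2
        rw [sum_eq_erase hmem heR, ← Finset.mul_prod_erase _ _ hmem, Finset.sum_insert heR,
          Finset.sum_insert he]
        have e1 : ∑ x ∈ U, v x + (v e + ∑ x ∈ X, v x) -
            (v e + ∑ x ∈ R, v x + ∑ t ∈ Q.erase (insert e R), ∑ x ∈ t, v x) =
            ∑ x ∈ U \ R, v x + ∑ x ∈ X, v x -
              ∑ t ∈ Q.erase (insert e R), ∑ x ∈ t, v x := by omega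
        have e2 : v e + ∑ x ∈ R, v x = (v e + ∑ x ∈ R₁, v x) + ∑ x ∈ R₂, v x := by omega
        rw [e1, e2]
        ring
      rw [Finset.sum_congr rfl hterm, ← Finset.mul_sum]
      refine (mul_le_mul_of_nonneg_left hih (by positivity)).trans (le_of_eq ?_)
      have e3 : ∑ x ∈ U \ R, v x + ∑ x ∈ X, v x - X.card =
          (∑ x ∈ U₁ \ R₁, v x + (∑ x ∈ X, v x - X.card)) + ∑ x ∈ U₂ \ R₂, v x := by omega
      rw [e3]
      ring
    refine (sum_le_sum_sum_filter (B := U₁.powerset ×ˢ U₂.powerset)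
      (fun Q R => insert e (R.1 ∪ R.2) ∈ Q) ?_ fun _ _ => by positivity).trans ?_
    · intro Q hQ
      obtain ⟨R, hR, hmem⟩ := (hF Q hQ).exists_eq_insert
      refine ⟨(R.filter fun x => v x = 1, R.filter fun x => ¬ v x = 1), ?_, ?_⟩
      · rw [Finset.mem_product, Finset.mem_powerset, Finset.mem_powerset]
        exact ⟨Finset.filter_subset_filter _ hR, Finset.filter_subset_filter _ hR⟩
      · simpa only [Finset.filter_union_filter_not_eq] using hmem
    rw [Finset.sum_product]
    have hR1 : ∀ R₁ ∈ U₁.powerset, ∑ R₂ ∈ U₂.powerset,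
        ∑ Q ∈ F.filter (fun Q => insert e (R₁ ∪ R₂) ∈ Q),
          ((∑ x ∈ U, v x + ∑ x ∈ insert e X, v x - ∑ t ∈ Q, ∑ x ∈ t, v x)! : ℝ) *
            ∏ t ∈ Q, ((∑ x ∈ t, v x)! : ℝ) ≤
        C * (18 * (2 / 3) ^ v e *
          ((∑ x ∈ U, v x + ∑ x ∈ insert e X, v x - (insert e X).card)! : ℝ)) *
          (1 ^ R₁.card * ((X.card : ℝ) + 1) ^ (U₁.card - R₁.card)) := by
      intro R₁ hR₁
      refine (Finset.sum_le_sum (hpair R₁ hR₁)).trans ?_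
      rw [← Finset.mul_sum]
      have hbox := sum_two_boxes_le U₂ v hU2 (q := v e + ∑ x ∈ R₁, v x)
        (Q := ∑ x ∈ U₁ \ R₁, v x + (∑ x ∈ X, v x - X.card)) (by omega)
      have hs1 := Finset.sum_sdiff (f := v) (Finset.mem_powerset.1 hR₁)
      have e4 : v e + ∑ x ∈ R₁, v x + (∑ x ∈ U₁ \ R₁, v x + (∑ x ∈ X, v x - X.card)) +
          ∑ x ∈ U₂, v x - 1 = ∑ x ∈ U, v x + ∑ x ∈ insert e X, v x - (insert e X).card := by
        rw [Finset.sum_insert he, Finset.card_insert_of_notMem he]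
        omega
      rw [e4] at hbox
      have hg : (2 / 3 : ℝ) ^ (v e + ∑ x ∈ R₁, v x) ≤ (2 / 3) ^ v e :=
        pow_le_pow_of_le_one (by norm_num) (by norm_num) (Nat.le_add_right _ _)
      calc _ ≤ C * ((X.card : ℝ) + 1) ^ (U₁.card - R₁.card) * (18 * (2 / 3) ^ v e *
          ((∑ x ∈ U, v x + ∑ x ∈ insert e X, v x - (insert e X).card)! : ℝ)) := by
            refine mul_le_mul_of_nonneg_left (hbox.trans ?_) (by positivity)
            gcongr
        _ = _ := by ring
    refine le_trans (le_of_eq (by congr!)) ((Finset.sum_le_sum hR1).trans ?_)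
    rw [← Finset.mul_sum, Finset.sum_pow_mul_eq_add_pow, Finset.prod_insert he,
      Finset.card_insert_of_notMem he, hC]
    push_cast
    apply le_of_eq
    ring

end IsRootedFamily

section MultiBracket

variable {ι J : Type*} [Fintype ι] [DecidableEq ι] [Fintype J] {o : ι → J} {v : ι → ℕ} {k : ℕ}

theorem IsComplementary.card_eq (ho : Function.Surjective o) {α : Finset (Finset ι)}
    (hc : IsComplementary (fiberPartition o) α) (hk : Fintype.card ι = Fintype.card J + k) :
    α.card = k + 1 := by
  have := hc.1
  rw [card_fiberPartition ho] at this
  omega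

theorem IsSetPartitionOn.erase_injective {α β : Finset (Finset ι)}
    (hα : IsSetPartitionOn Finset.univ α) (hβ : IsSetPartitionOn Finset.univ β)
    {s t : Finset ι} (hs : s ∈ α) (ht : t ∈ β) (h : α.erase s = β.erase t) : α = β := by
  have key : ∀ {γ : Finset (Finset ι)} {r : Finset ι}, IsSetPartitionOn Finset.univ γ → r ∈ γ →
      r = ((γ.erase r).biUnion id)ᶜ := by
    intro γ r hγ hr
    ext x
    simp only [Finset.mem_compl, Finset.mem_biUnion, Finset.mem_erase, id, not_exists, not_and]
    constructor
    · rintro hx q ⟨hne, hq⟩ hxq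
      exact hne (hγ.eq_of_mem hq hr hxq hx)
    · intro hx
      obtain ⟨q, ⟨hq, hxq⟩, -⟩ := hγ.2 x (Finset.mem_univ x)
      by_cases hqr : q = r
      · exact hqr ▸ hxq
      · exact absurd hxq (hx q ⟨hqr, hq⟩)
  have hst : s = t := by rw [key hα hs, key hβ ht, h]
  rw [← Finset.insert_erase hs, ← Finset.insert_erase ht, h, hst]

theorem card_compl_image_section {h : J → ι} (hh : ∀ j, o (h j) = j)
    (hk : Fintype.card ι = Fintype.card J + k) : (Finset.univ.image h)ᶜ.card = k := by
  have hinj : Function.Injective h := fun i j hij => by rw [← hh i, hij, hh j]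
  rw [Finset.card_compl, Finset.card_image_of_injective _ hinj, Finset.card_univ]
  omega

theorem card_ones_image_section_le (hone : ∀ x, v x = 1 → ∃ y, y ≠ x ∧ o y = o x) {h : J → ι}
    (hh : ∀ j, o (h j) = j) (hk : Fintype.card ι = Fintype.card J + k) :
    ((Finset.univ.image h).filter fun x => v x = 1).card ≤ k := by
  rw [← card_compl_image_section hh hk]
  choose! y hy using hone
  have himg : ∀ x ∈ Finset.univ.image h, h (o x) = x := fun x hx => by
    obtain ⟨j, -, rfl⟩ := Finset.mem_image.1 hx
    rw [hh]
  refine Finset.card_le_card_of_injOn y ?_ ?_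
  · intro x hx
    obtain ⟨hxU, hx1⟩ := Finset.mem_filter.1 hx
    obtain ⟨hne, hoy⟩ := hy x hx1
    rw [Finset.mem_coe, Finset.mem_compl]
    intro hyU
    exact hne (by rw [← himg _ hyU, hoy, himg _ hxU])
  · intro x hx x' hx' hxx
    obtain ⟨hxU, hx1⟩ := Finset.mem_filter.1 hx
    obtain ⟨hxU', hx1'⟩ := Finset.mem_filter.1 hx'
    rw [← himg x hxU, ← himg x' hxU', ← (hy x hx1).2, ← (hy x' hx1').2, hxx]

theorem card_ones_le (ho : Function.Surjective o)
    (hone : ∀ x, v x = 1 → ∃ y, y ≠ x ∧ o y = o x)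
    (hk : Fintype.card ι = Fintype.card J + k) :
    (Finset.univ.filter fun x => v x = 1).card ≤ 2 * k := by
  obtain ⟨h, hh⟩ := ho.hasRightInverse
  have h1 := card_ones_image_section_le hone hh hk
  have h2 := card_compl_image_section hh hk
  have hsub : (Finset.univ.filter fun x => v x = 1) ⊆
      ((Finset.univ.image h).filter fun x => v x = 1) ∪ (Finset.univ.image h)ᶜ := by
    intro x hx
    have := (Finset.mem_filter.1 hx).2
    by_cases hxU : x ∈ Finset.univ.image h
    · exact Finset.mem_union_left _ (Finset.mem_filter.2 ⟨hxU, this⟩)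
    · exact Finset.mem_union_right _ (Finset.mem_compl.2 hxU)
  have := (Finset.card_le_card hsub).trans (Finset.card_union_le _ _)
  omega

theorem prod_abs_innerSingle_le (ho : Function.Surjective o) (hv : ∀ x, 1 ≤ v x)
    (hone : ∀ x, v x = 1 → ∃ y, y ≠ x ∧ o y = o x)
    (hk : Fintype.card ι = Fintype.card J + k) {α : Finset (Finset ι)}
    (hα : IsSetPartitionOn Finset.univ α) (hc : IsComplementary (fiberPartition o) α) :
    |∏ s ∈ α, innerSingle s v| ≤
      9 * Real.exp 36 * (9 * Real.exp 36 * 121) ^ k * ∏ s ∈ α, ((∑ x ∈ s, v x)! : ℝ) := by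
  rw [Finset.abs_prod]
  have h1 : ∏ s ∈ α, |innerSingle s v| ≤ ∏ s ∈ α, (9 * Real.exp 36 *
      11 ^ (s.filter fun x => v x = 1).card * ((∑ x ∈ s, v x)! : ℝ)) :=
    Finset.prod_le_prod (fun _ _ => abs_nonneg _) fun s hs =>
      (abs_innerSingle_le (hα.1 s hs).2 v).trans
        (partitionSum_blockWeight_le v s fun x _ => hv x)
  refine h1.trans ?_
  have hexp : ∑ s ∈ α, (s.filter fun x => v x = 1).card =
      (Finset.univ.filter fun x => v x = 1).card := by
    have := hα.sum_eq (fun x => if v x = 1 then 1 else 0)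
    simpa only [Finset.sum_boole, Nat.cast_id] using this
  rw [Finset.prod_mul_distrib, Finset.prod_mul_distrib, Finset.prod_const,
    Finset.prod_pow_eq_pow_sum, hexp, hc.card_eq ho hk]
  have h11 : (11 : ℝ) ^ (Finset.univ.filter fun x => v x = 1).card ≤ 11 ^ (2 * k) :=
    pow_le_pow_right₀ (by norm_num) (card_ones_le ho hone hk)
  calc _ ≤ (9 * Real.exp 36) ^ (k + 1) * 11 ^ (2 * k) * ∏ s ∈ α, ((∑ x ∈ s, v x)! : ℝ) := by
        gcongr
    _ = _ := by
        have h121 : (11 : ℝ) ^ (2 * k) = 121 ^ k := by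
          rw [pow_mul]
          norm_num
        rw [h121, pow_succ, mul_pow (9 * Real.exp 36) 121]
        ring

theorem abs_innerMulti_le (ho : Function.Surjective o) (hv : ∀ x, 1 ≤ v x)
    (hone : ∀ x, v x = 1 → ∃ y, y ≠ x ∧ o y = o x)
    (hk : Fintype.card ι = Fintype.card J + k) :
    |innerMulti (fiberPartition o) v| ≤
      ∑ h ∈ Finset.univ.filter (fun h : J → ι => ∀ j, o (h j) = j),
        9 * Real.exp 36 * (9 * Real.exp 36 * 121) ^ k * (18 ^ k *
          (∏ x ∈ (Finset.univ.image h)ᶜ, (2 / 3 : ℝ) ^ v x) * ((k : ℝ) + 1) ^ k *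
          ((∑ x, v x - k)! : ℝ)) := by
  set A := Finset.univ.filter (fun α : Finset (Finset ι) =>
    IsSetPartitionOn Finset.univ α ∧ IsComplementary (fiberPartition o) α) with hA
  have hAmem : ∀ α ∈ A, IsSetPartitionOn Finset.univ α ∧
      IsComplementary (fiberPartition o) α := fun α h => (Finset.mem_filter.1 h).2
  have hmax : ∀ α ∈ A, ∃ s₀ ∈ α, ∀ s ∈ α, ∑ x ∈ s, v x ≤ ∑ x ∈ s₀, v x := fun α h =>
    Finset.exists_max_image α (fun s => ∑ x ∈ s, v x) (by
      rw [← Finset.card_pos, (hAmem α h).2.card_eq ho hk]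
      omega)
  choose! r hr hrmax using hmax
  refine (Finset.abs_sum_le_sum_abs _ _).trans ?_
  refine (Finset.sum_le_sum fun α hα =>
    prod_abs_innerSingle_le ho hv hone hk (hAmem α hα).1 (hAmem α hα).2).trans ?_
  rw [← Finset.mul_sum, ← Finset.mul_sum]
  refine mul_le_mul_of_nonneg_left ?_ (by positivity)
  refine (sum_le_sum_sum_filter (B := Finset.univ.filter (fun h : J → ι => ∀ j, o (h j) = j))
    (fun α h => r α ⊆ Finset.univ.image h ∧
      ∀ s ∈ α, s ≠ r α → (s ∩ (Finset.univ.image h)ᶜ).card = 1) ?_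
    fun _ _ => by positivity).trans ?_
  · intro α hα
    obtain ⟨h, hh, h1, h2⟩ := (hAmem α hα).2.exists_section ho (hAmem α hα).1 (hr α hα)
    exact ⟨h, Finset.mem_filter.2 ⟨Finset.mem_univ _, hh⟩, h1, h2⟩
  refine Finset.sum_le_sum fun h hh => ?_
  have hh := (Finset.mem_filter.1 hh).2
  set U := Finset.univ.image h with hU
  have hVU : ∑ x ∈ U, v x + ∑ x ∈ Uᶜ, v x = ∑ x, v x := Finset.sum_add_sum_compl U v
  set A' := A.filter fun α => r α ⊆ U ∧ ∀ s ∈ α, s ≠ r α → (s ∩ Uᶜ).card = 1 with hA'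
  have hsumerase : ∀ α ∈ A, ∑ x ∈ r α, v x + ∑ t ∈ α.erase (r α), ∑ x ∈ t, v x = ∑ x, v x := by
    intro α hα
    rw [Finset.add_sum_erase α (fun t => ∑ x ∈ t, v x) (hr α hα)]
    exact (hAmem α hα).1.sum_eq v
  have hmain := IsRootedFamily.sum_le (v := v) (X := Uᶜ) (U := U) (fun x _ => hv x)
    disjoint_compl_right (A'.image fun α => α.erase (r α)) (by
      intro Q hQ
      obtain ⟨α, hα', rfl⟩ := Finset.mem_image.1 hQ
      obtain ⟨hα, hrU, hcard⟩ := Finset.mem_filter.1 hα'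
      have hP := (hAmem α hα).1
      refine ⟨?_, ?_, ?_, ?_, ?_⟩
      · intro s _
        rw [Finset.union_compl]
        exact Finset.subset_univ s
      · intro s hs
        exact hcard s (Finset.mem_of_mem_erase hs) (Finset.mem_erase.1 hs).1
      · intro e he
        obtain ⟨s, ⟨hs, hes⟩, -⟩ := hP.2 e (Finset.mem_univ e)
        refine ⟨s, Finset.mem_erase.2 ⟨?_, hs⟩, hes⟩
        rintro rfl
        exact Finset.mem_compl.1 he (hrU hes)
      · intro s hs t ht hne
        exact hP.disjoint (Finset.mem_of_mem_erase hs) (Finset.mem_of_mem_erase ht) hne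
      · intro s hs
        rw [hVU, ← hsumerase α hα]
        exact Nat.add_le_add_right (hrmax α hα s (Finset.mem_of_mem_erase hs)) _)
  rw [Finset.sum_image (by
    intro α hα β hβ hαβ
    have h1 := (Finset.mem_filter.1 hα).1
    have h2 := (Finset.mem_filter.1 hβ).1
    exact (hAmem α h1).1.erase_injective (hAmem β h2).1 (hr α h1) (hr β h2) hαβ),
    hVU, card_compl_image_section hh hk] at hmain
  have hterm : ∀ α ∈ A', ∏ s ∈ α, ((∑ x ∈ s, v x)! : ℝ) =
      ((∑ x, v x - ∑ t ∈ α.erase (r α), ∑ x ∈ t, v x)! : ℝ) *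
        ∏ t ∈ α.erase (r α), ((∑ x ∈ t, v x)! : ℝ) := by
    intro α hα'
    have hα := (Finset.mem_filter.1 hα').1
    rw [← hsumerase α hα, Nat.add_sub_cancel_right,
      Finset.mul_prod_erase α (fun t => ((∑ x ∈ t, v x)! : ℝ)) (hr α hα)]
  refine le_trans (le_of_eq ?_) (hmain.trans ?_)
  · rw [← Finset.sum_congr rfl hterm]
    congr!
  · have hk1 : (1 : ℝ) ≤ (k : ℝ) + 1 := by
      have : (0 : ℝ) ≤ k := Nat.cast_nonneg k
      linarith
    have := pow_le_pow_right₀ hk1 (card_ones_image_section_le hone hh hk)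
    gcongr

end MultiBracket

section MultiplicitySum

/-- The product `∏_i M_i(λ)!` of the factorials of the multiplicities of `λ`. -/
noncomputable def countFactorial (l : Multiset ℕ) : ℕ :=
  ∏ i ∈ l.toFinset, (l.count i)!

theorem countFactorial_pos (l : Multiset ℕ) : 0 < countFactorial l :=
  Finset.prod_pos fun _ _ => Nat.factorial_pos _

theorem countFactorial_cons (q : ℕ) (l : Multiset ℕ) :
    countFactorial (q ::ₘ l) = (q ::ₘ l).count q * countFactorial l := by
  have hsub : l.toFinset ⊆ (q ::ₘ l).toFinset := by
    intro x hx
    rw [Multiset.mem_toFinset] at hx ⊢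
    exact Multiset.mem_cons_of_mem hx
  have hl : countFactorial l = ∏ i ∈ (q ::ₘ l).toFinset, (l.count i)! := by
    refine Finset.prod_subset hsub fun x _ hx => ?_
    rw [Multiset.mem_toFinset] at hx
    rw [Multiset.count_eq_zero_of_notMem hx, Nat.factorial_zero]
  have hq : q ∈ (q ::ₘ l).toFinset := by
    rw [Multiset.mem_toFinset]
    exact Multiset.mem_cons_self q l
  rw [hl, countFactorial, ← Finset.mul_prod_erase _ _ hq, ← Finset.mul_prod_erase _ _ hq,
    Multiset.count_cons_self, Nat.factorial_succ, mul_assoc]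
  congr 2
  refine Finset.prod_congr rfl fun x hx => ?_
  rw [Multiset.count_cons_of_ne (Finset.mem_erase.1 hx).1]

theorem countPerms_mul_countFactorial (l : Multiset ℕ) :
    l.countPerms * countFactorial l = (Multiset.card l)! := by
  rw [Multiset.countPerms, Finsupp.multinomial_eq, mul_comm, countFactorial]
  have h := Nat.multinomial_spec l.toFinset (fun i => l.count i)
  rw [Multiset.toFinset_sum_count_eq] at h
  rw [← h]
  congr 2

theorem sum_sym_prod_div_countFactorial (s : Finset ℕ) (w : ℕ → ℝ) (l : ℕ) :
    ∑ μ ∈ s.sym l, ((μ : Multiset ℕ).map w).prod / (countFactorial μ : ℝ) =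
      (∑ i ∈ s, w i) ^ l / (l ! : ℝ) := by
  rw [Finset.sum_pow, Finset.sum_div]
  refine Finset.sum_congr rfl fun μ _ => ?_
  have h := countPerms_mul_countFactorial (μ : Multiset ℕ)
  rw [Sym.card_coe] at h
  have h0 : (countFactorial (μ : Multiset ℕ) : ℝ) ≠ 0 := by
    exact_mod_cast (countFactorial_pos _).ne'
  have h1 : (l ! : ℝ) ≠ 0 := by positivity
  rw [div_eq_div_iff h0 h1, ← h]
  push_cast
  change _ = ((μ : Multiset ℕ).countPerms : ℝ) * (Multiset.map w (μ : Multiset ℕ)).prod * _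
  ring

theorem mem_partitionsOfWeight {w : ℕ} {l : Multiset ℕ} :
    l ∈ partitionsOfWeight w → (∀ p ∈ l, 1 ≤ p) ∧ l.sum + Multiset.card l = w := by
  intro h
  obtain ⟨μ, hμ, rfl⟩ := Finset.mem_image.1 h
  have hμ2 := (Finset.mem_filter.1 hμ).2
  constructor
  · intro p hp
    obtain ⟨q, hq, rfl⟩ := Multiset.mem_map.1 hp
    have := hμ2 q hq
    omega
  · have h1 : (μ.parts.map fun p => p - 1).sum + (μ.parts.map fun _ => 1).sum =
        μ.parts.sum := by
      rw [← Multiset.sum_map_add]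
      conv_rhs => rw [← Multiset.map_id μ.parts]
      congr 1
      refine Multiset.map_congr rfl fun q hq => ?_
      have := hμ2 q hq
      simp only [id]
      omega
    rw [Multiset.map_const', Multiset.sum_replicate, smul_eq_mul, mul_one, μ.parts_sum] at h1
    rw [Multiset.card_map]
    exact h1

/-- The contribution of one partition to the sum over all tuples of partitions, with
`γ(q) = (2/3)^q`. -/
noncomputable def partitionFactor (c : ℝ) (l : Multiset ℕ) : ℝ :=
  c ^ (Multiset.card l - 1) / (countFactorial l : ℝ) *
    ((l.map fun q => (2 / 3 : ℝ) ^ q).prod * (l.map fun q => ((2 / 3 : ℝ) ^ q)⁻¹).sum)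

theorem partitionFactor_eq_sum (c : ℝ) (l : Multiset ℕ) :
    partitionFactor c l = ∑ q ∈ l.toFinset,
      ((l.erase q).map fun q => c * (2 / 3 : ℝ) ^ q).prod / (countFactorial (l.erase q) : ℝ) := by
  rw [partitionFactor, Finset.sum_multiset_map_count, Finset.mul_sum, Finset.mul_sum]
  refine Finset.sum_congr rfl fun q hq => ?_
  obtain ⟨μ, rfl⟩ := Multiset.exists_cons_of_mem (Multiset.mem_toFinset.1 hq)
  have h0 : (countFactorial μ : ℝ) ≠ 0 := by exact_mod_cast (countFactorial_pos _).ne'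
  have h1 : (((q ::ₘ μ).count q : ℕ) : ℝ) ≠ 0 := by
    rw [Multiset.count_cons_self]
    positivity
  have h2 : ((2 / 3 : ℝ) ^ q) ≠ 0 := by positivity
  rw [Multiset.erase_cons_head, countFactorial_cons, Multiset.map_cons, Multiset.prod_cons,
    Multiset.prod_map_mul, Multiset.map_const', Multiset.prod_replicate, Multiset.card_cons,
    Nat.add_sub_cancel, nsmul_eq_mul]
  push_cast
  field_simp

theorem partitionFactor_nonneg {c : ℝ} (hc : 0 ≤ c) (l : Multiset ℕ) : 0 ≤ partitionFactor c l := by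
  rw [partitionFactor_eq_sum]
  refine Finset.sum_nonneg fun q _ => div_nonneg (Multiset.prod_nonneg ?_) (Nat.cast_nonneg _)
  intro a ha
  obtain ⟨b, -, rfl⟩ := Multiset.mem_map.1 ha
  positivity

theorem sum_partitionFactor_le {c : ℝ} (hc : 0 ≤ c) (w : ℕ) :
    ∑ l ∈ partitionsOfWeight w, partitionFactor c l ≤ Real.exp (3 * c) := by
  simp only [partitionFactor_eq_sum]
  rw [Finset.sum_sigma']
  have hle := sum_le_sum_of_injOn_map
    (A := (partitionsOfWeight w).sigma fun l => l.toFinset)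
    (B := (Finset.range (w + 1)).sigma fun l => (Finset.range (w + 1)).sym l)
    (F := fun x => ((x.1.erase x.2).map fun q => c * (2 / 3 : ℝ) ^ q).prod /
      (countFactorial (x.1.erase x.2) : ℝ))
    (G := fun z : Σ l : ℕ, Sym ℕ l => ((z.2 : Multiset ℕ).map fun q => c * (2 / 3 : ℝ) ^ q).prod /
      (countFactorial (z.2 : Multiset ℕ) : ℝ))
    (fun x => (⟨Multiset.card (x.1.erase x.2), ⟨x.1.erase x.2, rfl⟩⟩ : Σ l : ℕ, Sym ℕ l))
    ?_ ?_ (fun _ _ => le_rfl) ?_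
  · refine hle.trans ?_
    rw [Finset.sum_sigma]
    simp only [sum_sym_prod_div_countFactorial]
    rw [← Finset.mul_sum]
    have hgeom : ∑ i ∈ Finset.range (w + 1), (2 / 3 : ℝ) ^ i ≤ 3 := by
      rw [geom_sum_eq (by norm_num)]
      have : (0 : ℝ) ≤ (2 / 3 : ℝ) ^ (w + 1) := by positivity
      rw [div_le_iff_of_neg (by norm_num)]
      linarith
    have hx : c * ∑ i ∈ Finset.range (w + 1), (2 / 3 : ℝ) ^ i ≤ 3 * c := by
      rw [mul_comm]
      exact mul_le_mul_of_nonneg_right hgeom hc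
    have hx0 : 0 ≤ c * ∑ i ∈ Finset.range (w + 1), (2 / 3 : ℝ) ^ i :=
      mul_nonneg hc (Finset.sum_nonneg fun _ _ => by positivity)
    exact (Real.sum_le_exp_of_nonneg hx0 _).trans (Real.exp_le_exp.2 hx)
  · rintro ⟨l, q⟩ hx
    obtain ⟨hl, hq⟩ := Finset.mem_sigma.1 hx
    dsimp only at hl hq
    obtain ⟨hl1, hl2⟩ := mem_partitionsOfWeight hl
    have hcard : Multiset.card (l.erase q) ≤ w :=
      (Multiset.card_le_card (Multiset.erase_le q l)).trans (by omega)
    refine Finset.mem_sigma.2 ⟨Finset.mem_range.2 (Nat.lt_succ_of_le hcard), ?_⟩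
    refine Finset.mem_sym_iff.2 fun a ha => Finset.mem_range.2 ?_
    have ha' : a ∈ l := Multiset.mem_of_mem_erase (show a ∈ l.erase q from ha)
    have := Multiset.le_sum_of_mem ha'
    omega
  · rintro ⟨l, q⟩ hx ⟨l', q'⟩ hx' heq
    obtain ⟨hl, hq⟩ := Finset.mem_sigma.1 hx
    obtain ⟨hl', hq'⟩ := Finset.mem_sigma.1 hx'
    dsimp only at hl hq hl' hq'
    obtain ⟨μ, rfl⟩ := Multiset.exists_cons_of_mem (Multiset.mem_toFinset.1 hq)
    obtain ⟨μ', rfl⟩ := Multiset.exists_cons_of_mem (Multiset.mem_toFinset.1 hq')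
    have hμ : (q ::ₘ μ).erase q = (q' ::ₘ μ').erase q' :=
      congrArg (fun z : Σ l : ℕ, Sym ℕ l => (z.2 : Multiset ℕ)) heq
    rw [Multiset.erase_cons_head, Multiset.erase_cons_head] at hμ
    subst hμ
    have h1 := (mem_partitionsOfWeight hl).2
    have h2 := (mem_partitionsOfWeight hl').2
    simp only [Multiset.sum_cons, Multiset.card_cons] at h1 h2
    obtain rfl : q = q' := by omega
    rfl
  · rintro ⟨l, μ⟩ _
    refine div_nonneg (Multiset.prod_nonneg ?_) (Nat.cast_nonneg _)
    intro a ha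
    obtain ⟨b, -, rfl⟩ := Multiset.mem_map.1 ha
    positivity

end MultiplicitySum

theorem succ_pow_le_nine_pow_mul_factorial (k : ℕ) :
    ((k : ℝ) + 1) ^ k ≤ 9 ^ k * (k ! : ℝ) := by
  rcases Nat.eq_zero_or_pos k with rfl | hk
  · simp
  · have h1 := Real.pow_div_factorial_le_exp ((k : ℝ) + 1) (by positivity) k
    have h2 : Real.exp ((k : ℝ) + 1) ≤ 9 ^ k := by
      have h3 : Real.exp ((k : ℝ) + 1) = Real.exp 1 ^ (k + 1) := by
        rw [← Real.exp_nat_mul]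
        push_cast
        ring_nf
      rw [h3]
      calc Real.exp 1 ^ (k + 1) ≤ 3 ^ (k + 1) :=
            pow_le_pow_left₀ (Real.exp_pos 1).le (by linarith [Real.exp_one_lt_d9]) _
        _ ≤ 3 ^ (2 * k) := pow_le_pow_right₀ (by norm_num) (by omega)
        _ = 9 ^ k := by
            rw [pow_mul]
            norm_num
    rw [div_le_iff₀ (by positivity)] at h1
    exact h1.trans (mul_le_mul_of_nonneg_right h2 (by positivity))

theorem succ_pow_mul_pow_mul_factorial_le {N k : ℕ} (hk : 1 ≤ k) (hN : 2 * k + 1 ≤ N) :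
    ((k : ℝ) + 1) ^ k * (N : ℝ) ^ k * ((N - 2 * k)! : ℝ) ≤ 18 ^ k * ((N - 1)! : ℝ) := by
  have h1 : (N : ℝ) ^ k ≤ 2 ^ k * ((N - k : ℕ) : ℝ) ^ k := by
    rw [← mul_pow]
    refine pow_le_pow_left₀ (by positivity) ?_ k
    rw [Nat.cast_sub (by omega)]
    have : (2 * k + 1 : ℝ) ≤ N := by exact_mod_cast hN
    linarith
  have h2 : (k ! : ℝ) * ((N - 2 * k)! : ℝ) ≤ ((N - k - 1)! : ℝ) := by
    have := factorial_mul_factorial_antitone (A := 1) (B := 1) (u := k) (y := N - 2 * k) le_rfl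
      le_rfl hk (by omega)
    simp only [Nat.factorial_one, mul_one, Nat.add_sub_cancel] at this
    rw [show k + (N - 2 * k) - 1 = N - k - 1 by omega] at this
    exact_mod_cast this
  have h3 : ((N - k - 1)! : ℝ) * ((N - k : ℕ) : ℝ) ^ k ≤ ((N - 1)! : ℝ) := by
    have := Nat.factorial_mul_pow_le_factorial (m := N - k - 1) (n := k)
    rw [show N - k - 1 + 1 = N - k by omega, show N - k - 1 + k = N - 1 by omega] at this
    exact_mod_cast this
  calc ((k : ℝ) + 1) ^ k * (N : ℝ) ^ k * ((N - 2 * k)! : ℝ)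
      ≤ (9 ^ k * (k ! : ℝ)) * (2 ^ k * ((N - k : ℕ) : ℝ) ^ k) * ((N - 2 * k)! : ℝ) := by
        gcongr
        exact succ_pow_le_nine_pow_mul_factorial k
    _ = (9 ^ k * 2 ^ k) * (((k ! : ℝ) * ((N - 2 * k)! : ℝ)) * ((N - k : ℕ) : ℝ) ^ k) := by ring
    _ ≤ (9 ^ k * 2 ^ k) * (((N - k - 1)! : ℝ) * ((N - k : ℕ) : ℝ) ^ k) := by gcongr
    _ ≤ (9 ^ k * 2 ^ k) * ((N - 1)! : ℝ) := by gcongr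
    _ = 18 ^ k * ((N - 1)! : ℝ) := by
        rw [← mul_pow]
        norm_num

section TupleSum

theorem sum_sections_prod_compl_image {ι J : Type*} [Fintype ι] [DecidableEq ι] [Fintype J]
    (o : ι → J) (w : ι → ℝ) (hw : ∀ x, w x ≠ 0) :
    ∑ h ∈ Finset.univ.filter (fun h : J → ι => ∀ j, o (h j) = j),
        ∏ x ∈ (Finset.univ.image h)ᶜ, w x =
      ∏ j, ((∏ x ∈ Finset.univ.filter (fun x => o x = j), w x) *
        ∑ x ∈ Finset.univ.filter (fun x => o x = j), (w x)⁻¹) := by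
  have hpi : (Finset.univ.filter fun h : J → ι => ∀ j, o (h j) = j) =
      Fintype.piFinset fun j => Finset.univ.filter fun x => o x = j := by
    ext h
    simp
  have hfib : ∏ j, ∏ x ∈ Finset.univ.filter (fun x => o x = j), w x = ∏ x, w x := by
    convert Finset.prod_fiberwise Finset.univ o w
  rw [Finset.prod_mul_distrib, Finset.prod_univ_sum, hfib, Finset.mul_sum, ← hpi]
  refine Finset.sum_congr rfl fun h hh => ?_
  have hh := (Finset.mem_filter.1 hh).2
  have hinj : Function.Injective h := fun i j hij => by rw [← hh i, hij, hh j]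
  have hne : ∏ j, w (h j) ≠ 0 := Finset.prod_ne_zero_iff.2 fun j _ => hw _
  rw [Finset.prod_inv_distrib, ← Finset.prod_mul_prod_compl (Finset.univ.image h) w,
    Finset.prod_image fun _ _ _ _ hij => hinj hij]
  field_simp

theorem abs_innerMulti_le_prod {ι J : Type*} [Fintype ι] [DecidableEq ι] [Fintype J] {o : ι → J}
    {v : ι → ℕ} {k : ℕ} (ho : Function.Surjective o) (hv : ∀ x, 1 ≤ v x)
    (hone : ∀ x, v x = 1 → ∃ y, y ≠ x ∧ o y = o x)
    (hk : Fintype.card ι = Fintype.card J + k) :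
    |innerMulti (fiberPartition o) v| ≤
      9 * Real.exp 36 * (9 * Real.exp 36 * 121 * 18) ^ k *
        (((k : ℝ) + 1) ^ k * ((∑ x, v x - k)! : ℝ)) *
        ∏ j, ((∏ x ∈ Finset.univ.filter (fun x => o x = j), (2 / 3 : ℝ) ^ v x) *
          ∑ x ∈ Finset.univ.filter (fun x => o x = j), ((2 / 3 : ℝ) ^ v x)⁻¹) := by
  refine (abs_innerMulti_le ho hv hone hk).trans (le_of_eq ?_)
  rw [← sum_sections_prod_compl_image o (fun x => (2 / 3 : ℝ) ^ v x) fun x => by positivity,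
    Finset.mul_sum]
  refine Finset.sum_congr rfl fun h _ => ?_
  rw [mul_pow (9 * Real.exp 36 * 121) 18]
  ring

theorem Multiset.sum_fin_toList {M : Type*} [AddCommMonoid M] (l : Multiset ℕ) (f : ℕ → M) :
    ∑ i : Fin l.toList.length, f (l.toList.get i) = (l.map f).sum := by
  have := Fin.sum_univ_fun_getElem l.toList f
  simp only [List.get_eq_getElem]
  rw [this, ← Multiset.sum_coe, ← Multiset.map_coe, Multiset.coe_toList]

theorem Multiset.prod_fin_toList {M : Type*} [CommMonoid M] (l : Multiset ℕ) (f : ℕ → M) :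
    ∏ i : Fin l.toList.length, f (l.toList.get i) = (l.map f).prod := by
  have := Fin.prod_univ_fun_getElem l.toList f
  simp only [List.get_eq_getElem]
  rw [this, ← Multiset.prod_coe, ← Multiset.map_coe, Multiset.coe_toList]

theorem Finset.sum_filter_sigma_fst {J M : Type*} [Fintype J] [AddCommMonoid M] {κ : J → Type*}
    [∀ j, Fintype (κ j)] (f : (Σ j, κ j) → M) (j : J)
    [DecidablePred fun x : Σ j, κ j => x.1 = j] :
    ∑ x ∈ Finset.univ.filter (fun x : Σ j, κ j => x.1 = j), f x = ∑ i, f ⟨j, i⟩ := by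
  rw [Finset.sum_filter, Fintype.sum_sigma, Finset.sum_eq_single j]
  · simp
  · intro b _ hb
    simp [hb]
  · simp

theorem Finset.prod_filter_sigma_fst {J M : Type*} [Fintype J] [CommMonoid M] {κ : J → Type*}
    [∀ j, Fintype (κ j)] (f : (Σ j, κ j) → M) (j : J)
    [DecidablePred fun x : Σ j, κ j => x.1 = j] :
    ∏ x ∈ Finset.univ.filter (fun x : Σ j, κ j => x.1 = j), f x = ∏ i, f ⟨j, i⟩ := by
  rw [Finset.prod_filter, Fintype.prod_sigma, Finset.prod_eq_single j]
  · simp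
  · intro b _ hb
    simp [hb]
  · simp

variable {n : ℕ} {m : Fin n → ℕ} {T : Fin n → Multiset ℕ}

theorem surjective_fst_of_mem (hT : ∀ j, T j ∈ partitionsOfWeight (m j + 1)) :
    Function.Surjective (Sigma.fst : (Σ j, Fin (T j).toList.length) → Fin n) := by
  intro j
  have h : 0 < (T j).toList.length := by
    rw [Multiset.length_toList, Multiset.card_pos]
    intro h0
    have := (mem_partitionsOfWeight (hT j)).2
    simp [h0] at this
  exact ⟨⟨j, ⟨0, h⟩⟩, rfl⟩

theorem card_sigma_toList (T : Fin n → Multiset ℕ) :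
    Fintype.card (Σ j, Fin (T j).toList.length) = ∑ j, Multiset.card (T j) := by
  simp

theorem sum_sigma_toList (T : Fin n → Multiset ℕ) :
    ∑ x : Σ j, Fin (T j).toList.length, (T x.1).toList.get x.2 = ∑ j, (T j).sum := by
  rw [Fintype.sum_sigma]
  refine Finset.sum_congr rfl fun j _ => ?_
  have := Multiset.sum_fin_toList (T j) id
  rw [Multiset.map_id] at this
  exact this

theorem one_le_card_of_mem (hT : ∀ j, T j ∈ partitionsOfWeight (m j + 1)) (j : Fin n) :
    1 ≤ Multiset.card (T j) := by
  by_contra h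
  have h0 : T j = 0 := Multiset.card_eq_zero.1 (by omega)
  have := (mem_partitionsOfWeight (hT j)).2
  simp [h0] at this

theorem get_mem_toList (l : Multiset ℕ) (i : Fin l.toList.length) : l.toList.get i ∈ l := by
  rw [← Multiset.mem_toList]
  exact List.get_mem _ _

theorem abs_term_le (hm : ∀ j, 2 ≤ m j) (hT : ∀ j, T j ∈ partitionsOfWeight (m j + 1))
    (hne : ∃ j, 2 ≤ Multiset.card (T j)) :
    |innerMulti (fiberPartition (Sigma.fst : (Σ j, Fin (T j).toList.length) → Fin n))
        (fun x => (T x.1).toList.get x.2) *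
      ∏ j, ((-(m j : ℝ)) ^ (Multiset.card (T j) - 1) / (countFactorial (T j) : ℝ))| ≤
    9 * Real.exp 36 * ((∑ j, m j - 1)! : ℝ) *
      ∏ j, partitionFactor (9 * Real.exp 36 * 121 * 18 * 18 * m j / ((∑ j, m j : ℕ) : ℝ)) (T j) := by
  set N := ∑ j, m j with hN
  set k := ∑ j, (Multiset.card (T j) - 1) with hk
  have hcard1 := one_le_card_of_mem hT
  have hkcard : ∑ j, Multiset.card (T j) = n + k := by
    have : ∑ j : Fin n, Multiset.card (T j) = ∑ j : Fin n, (1 + (Multiset.card (T j) - 1)) :=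
      Finset.sum_congr rfl fun j _ => by have := hcard1 j; omega
    rw [this, Finset.sum_add_distrib]
    simp [hk]
  have hsumT : ∑ j, (T j).sum + ∑ j, Multiset.card (T j) = N + n := by
    rw [← Finset.sum_add_distrib, Finset.sum_congr rfl fun j _ => (mem_partitionsOfWeight (hT j)).2,
      Finset.sum_add_distrib]
    simp [hN]
  have hcardle : ∑ j, Multiset.card (T j) ≤ ∑ j, (T j).sum := by
    refine Finset.sum_le_sum fun j _ => ?_
    have := Multiset.card_nsmul_le_sum (s := T j) (a := 1) fun x hx =>
      (mem_partitionsOfWeight (hT j)).1 x hx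
    simpa using this
  obtain ⟨j₀, hj₀⟩ := hne
  have hk1 : 1 ≤ k := by
    have : Multiset.card (T j₀) - 1 ≤ k :=
      Finset.single_le_sum (f := fun j => Multiset.card (T j) - 1) (fun _ _ => Nat.zero_le _)
        (Finset.mem_univ j₀)
    omega
  have hn : 1 ≤ n := Nat.one_le_iff_ne_zero.2 fun h0 => by
    subst h0
    exact j₀.elim0
  have hNk : 2 * k + 1 ≤ N := by omega
  have hbound := abs_innerMulti_le_prod (o := (Sigma.fst : (Σ j, Fin (T j).toList.length) → Fin n))
    (v := fun x => (T x.1).toList.get x.2) (k := k) (surjective_fst_of_mem hT)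
    (fun x => (mem_partitionsOfWeight (hT x.1)).1 _ (get_mem_toList _ _))
    (by
      rintro ⟨j, i⟩ hx
      dsimp only at hx
      have hmem := get_mem_toList (T j) i
      have hlen : 2 ≤ (T j).toList.length := by
        rw [Multiset.length_toList]
        by_contra hlt
        obtain ⟨a, ha⟩ := Multiset.card_eq_one.1 (show Multiset.card (T j) = 1 by
          have := hcard1 j
          omega)
        rw [hx, ha, Multiset.mem_singleton] at hmem
        have := (mem_partitionsOfWeight (hT j)).2
        rw [ha, Multiset.sum_singleton, Multiset.card_singleton] at this
        have := hm j
        omega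
      have := Fin.nontrivial_iff_two_le.2 hlen
      obtain ⟨i', hi'⟩ := exists_ne i
      exact ⟨⟨j, i'⟩, by simpa using hi', rfl⟩)
    (by rw [card_sigma_toList, hkcard, Fintype.card_fin])
  rw [sum_sigma_toList, show ∑ j, (T j).sum - k = N - 2 * k by omega] at hbound
  have hprod : ∀ (j) (_ : DecidablePred fun x : Σ j, Fin (T j).toList.length => x.1 = j), ((∏ x ∈ Finset.univ.filter
        (fun x : Σ j, Fin (T j).toList.length => x.1 = j),
        (2 / 3 : ℝ) ^ (T x.1).toList.get x.2) *
      ∑ x ∈ Finset.univ.filter (fun x : Σ j, Fin (T j).toList.length => x.1 = j),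
        ((2 / 3 : ℝ) ^ (T x.1).toList.get x.2)⁻¹) =
      ((T j).map fun q => (2 / 3 : ℝ) ^ q).prod * ((T j).map fun q => ((2 / 3 : ℝ) ^ q)⁻¹).sum := by
    intro j inst
    rw [← Multiset.sum_fin_toList, ← Multiset.prod_fin_toList]
    congr 1
    · exact Finset.prod_filter_sigma_fst (κ := fun j => Fin (T j).toList.length)
        (fun x => (2 / 3 : ℝ) ^ (T x.1).toList.get x.2) j
    · exact Finset.sum_filter_sigma_fst (κ := fun j => Fin (T j).toList.length)
        (fun x => ((2 / 3 : ℝ) ^ (T x.1).toList.get x.2)⁻¹) j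
  rw [Finset.prod_congr rfl fun j _ => hprod j fun _ => Classical.propDecidable _] at hbound
  have hN0 : (0 : ℝ) < (N : ℝ) := by
    have : 0 < N := by omega
    exact_mod_cast this
  have hfac : ((k : ℝ) + 1) ^ k * ((N - 2 * k)! : ℝ) ≤ (18 / (N : ℝ)) ^ k * ((N - 1)! : ℝ) := by
    have := succ_pow_mul_pow_mul_factorial_le hk1 hNk
    rw [div_pow, div_mul_eq_mul_div, le_div_iff₀ (by positivity)]
    linarith
  have hQ : 0 ≤ ∏ j, (((T j).map fun q => (2 / 3 : ℝ) ^ q).prod *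
      ((T j).map fun q => ((2 / 3 : ℝ) ^ q)⁻¹).sum) := by
    refine Finset.prod_nonneg fun j _ => mul_nonneg (Multiset.prod_nonneg ?_)
      (Multiset.sum_nonneg ?_)
    all_goals
      intro a ha
      obtain ⟨b, -, rfl⟩ := Multiset.mem_map.1 ha
      positivity
  have habs : |∏ j, ((-(m j : ℝ)) ^ (Multiset.card (T j) - 1) / (countFactorial (T j) : ℝ))| =
      ∏ j, ((m j : ℝ) ^ (Multiset.card (T j) - 1) / (countFactorial (T j) : ℝ)) := by
    rw [Finset.abs_prod]
    refine Finset.prod_congr rfl fun j _ => ?_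
    rw [abs_div, abs_pow, abs_neg, Nat.abs_cast, Nat.abs_cast]
  rw [abs_mul, habs]
  refine (mul_le_mul_of_nonneg_right hbound (Finset.prod_nonneg fun _ _ => by positivity)).trans ?_
  refine (mul_le_mul_of_nonneg_right (mul_le_mul_of_nonneg_right
    (mul_le_mul_of_nonneg_left hfac (by positivity)) hQ)
      (Finset.prod_nonneg fun _ _ => by positivity)).trans (le_of_eq ?_)
  have hpow : (9 * Real.exp 36 * 121 * 18 * 18 / (N : ℝ)) ^ k =
      ∏ j, (9 * Real.exp 36 * 121 * 18 * 18 / (N : ℝ)) ^ (Multiset.card (T j) - 1) := by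
    rw [Finset.prod_pow_eq_pow_sum]
  have hfactor : ∏ j, partitionFactor (9 * Real.exp 36 * 121 * 18 * 18 * m j / (N : ℝ)) (T j) =
      (∏ j, (9 * Real.exp 36 * 121 * 18 * 18 / (N : ℝ)) ^ (Multiset.card (T j) - 1)) *
      (∏ j, ((m j : ℝ) ^ (Multiset.card (T j) - 1) / (countFactorial (T j) : ℝ))) *
      ∏ j, (((T j).map fun q => (2 / 3 : ℝ) ^ q).prod *
        ((T j).map fun q => ((2 / 3 : ℝ) ^ q)⁻¹).sum) := by
    rw [← Finset.prod_mul_distrib, ← Finset.prod_mul_distrib]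
    refine Finset.prod_congr rfl fun j _ => ?_
    rw [partitionFactor, mul_div_right_comm (9 * Real.exp 36 * 121 * 18 * 18) (m j : ℝ) (N : ℝ),
      mul_pow]
    ring
  rw [hfactor, ← hpow, mul_div_assoc (9 * Real.exp 36 * 121 * 18) 18 (N : ℝ),
    mul_pow (9 * Real.exp 36 * 121 * 18) (18 / (N : ℝ))]
  ring

theorem sum_prod_partitionFactor_le {c : ℝ} (hc : 0 ≤ c) (hN : 0 < ∑ j, m j) :
    ∑ T ∈ Fintype.piFinset fun j : Fin n => partitionsOfWeight (m j + 1),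
      ∏ j, partitionFactor (c * m j / ((∑ j, m j : ℕ) : ℝ)) (T j) ≤ Real.exp (3 * c) := by
  rw [← Finset.prod_univ_sum (fun j => partitionsOfWeight (m j + 1))
    (fun j l => partitionFactor (c * m j / ((∑ j, m j : ℕ) : ℝ)) l)]
  have hc0 : ∀ j, 0 ≤ c * m j / ((∑ j, m j : ℕ) : ℝ) := fun j => by positivity
  calc _ ≤ ∏ j, Real.exp (3 * (c * m j / ((∑ j, m j : ℕ) : ℝ))) :=
        Finset.prod_le_prod (fun j _ => Finset.sum_nonneg fun l _ =>
          partitionFactor_nonneg (hc0 j) l) fun j _ => sum_partitionFactor_le (hc0 j) _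
    _ = Real.exp (3 * c) := ?_
  rw [← Real.exp_sum]
  congr 1
  have : ((∑ j, m j : ℕ) : ℝ) ≠ 0 := by exact_mod_cast hN.ne'
  rw [← Finset.mul_sum, ← Finset.sum_div, ← Finset.mul_sum]
  push_cast at this ⊢
  rw [mul_div_assoc, div_self this, mul_one]

end TupleSum

section MainTerm

theorem innerMulti_fiberPartition_of_card_eq {ι J : Type*} [Fintype ι] [DecidableEq ι] [Fintype J]
    [Nonempty ι] {o : ι → J} (v : ι → ℕ) (ho : Function.Surjective o)
    (hcard : Fintype.card ι = Fintype.card J) :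
    innerMulti (fiberPartition o) v = innerSingle Finset.univ v := by
  have hne : (Finset.univ : Finset ι) ≠ ∅ := Finset.univ_nonempty.ne_empty
  have hfilter : (Finset.univ.filter fun α : Finset (Finset ι) =>
      IsSetPartitionOn Finset.univ α ∧ IsComplementary (fiberPartition o) α) =
      {{Finset.univ}} := by
    ext α
    simp only [Finset.mem_filter, Finset.mem_univ, true_and, Finset.mem_singleton]
    constructor
    · rintro ⟨hα, hc⟩
      exact hα.eq_singleton_of_card_le_one hne (hc.card_eq ho (k := 0) hcard).le
    · rintro rfl
      refine ⟨IsSetPartitionOn.singleton hne, ?_, fun γ hγ _ href => ?_⟩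
      · rw [card_fiberPartition ho, Finset.card_singleton, hcard]
      · obtain ⟨t, ht, hsub⟩ := href Finset.univ (Finset.mem_singleton_self _)
        exact hγ.eq_singleton (Finset.univ_subset_iff.1 hsub ▸ ht)
  rw [innerMulti, hfilter, Finset.sum_singleton, Finset.prod_singleton]

variable {n : ℕ} {m : Fin n → ℕ}

theorem singleton_mem_partitionsOfWeight {a : ℕ} (ha : 1 ≤ a) :
    ({a} : Multiset ℕ) ∈ partitionsOfWeight (a + 1) := by
  refine Finset.mem_image.2 ⟨Nat.Partition.indiscrete (a + 1), Finset.mem_filter.2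
    ⟨Finset.mem_univ _, ?_⟩, ?_⟩
  · intro p hp
    rw [Nat.Partition.indiscrete_parts (by omega), Multiset.mem_singleton] at hp
    omega
  · rw [Nat.Partition.indiscrete_parts (by omega), Multiset.map_singleton, Nat.add_sub_cancel]

theorem exists_two_le_card_of_ne {T : Fin n → Multiset ℕ}
    (hT : ∀ j, T j ∈ partitionsOfWeight (m j + 1)) (hne : T ≠ fun j => {m j}) :
    ∃ j, 2 ≤ Multiset.card (T j) := by
  by_contra! hlt
  refine hne (funext fun j => ?_)
  have h1 := one_le_card_of_mem hT j
  have h2 := hlt j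
  obtain ⟨a, ha⟩ := Multiset.card_eq_one.1 (show Multiset.card (T j) = 1 by omega)
  have := (mem_partitionsOfWeight (hT j)).2
  rw [ha, Multiset.sum_singleton, Multiset.card_singleton] at this
  rw [ha, show a = m j by omega]

/-- The summand of `innerF` at a tuple `T` of partitions. -/
noncomputable def innerFTerm (m : Fin n → ℕ) (T : Fin n → Multiset ℕ) : ℝ :=
  innerMulti (fiberPartition (Sigma.fst : (Σ j, Fin (T j).toList.length) → Fin n))
      (fun x => (T x.1).toList.get x.2) *
    ∏ j, ((-(m j : ℝ)) ^ (Multiset.card (T j) - 1) / (countFactorial (T j) : ℝ))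

theorem innerF_eq_sum (m : Fin n → ℕ) :
    innerF m = ∑ T ∈ Fintype.piFinset fun j : Fin n => partitionsOfWeight (m j + 1),
      innerFTerm m T := by
  refine Finset.sum_congr rfl fun T _ => ?_
  rw [innerFTerm]
  congr 1
  · rw [fiberPartition]
    congr!
  · refine Finset.prod_congr rfl fun j _ => ?_
    rw [countFactorial, Nat.cast_prod]

theorem innerFTerm_singleton (hm : ∀ j, 2 ≤ m j) (hn : 0 < n) :
    ∃ E : ℝ, innerFTerm m (fun j => {m j}) =
        ((∑ j, m j)! : ℝ) * zed ((∑ j, m j : ℤ) - n + 2) + E ∧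
      |E| ≤ 648 * Real.exp 36 * ((∑ j, m j - 1)! : ℝ) := by
  set T : Fin n → Multiset ℕ := fun j => {m j} with hTdef
  have hT : ∀ j, T j ∈ partitionsOfWeight (m j + 1) := fun j =>
    singleton_mem_partitionsOfWeight (by have := hm j; omega)
  have ho := surjective_fst_of_mem hT
  have hcard : Fintype.card (Σ j, Fin (T j).toList.length) = Fintype.card (Fin n) := by
    rw [card_sigma_toList]
    simp [hTdef]
  have hnon : Nonempty (Σ j, Fin (T j).toList.length) := by
    obtain ⟨x, -⟩ := ho ⟨0, hn⟩
    exact ⟨x⟩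
  have hsum : ∑ x : Σ j, Fin (T j).toList.length, (T x.1).toList.get x.2 = ∑ j, m j := by
    rw [sum_sigma_toList]
    simp [hTdef]
  have hcoef : ∏ j, ((-(m j : ℝ)) ^ (Multiset.card (T j) - 1) / (countFactorial (T j) : ℝ)) = 1 :=
    Finset.prod_eq_one fun j _ => by simp [hTdef, countFactorial]
  refine ⟨Emap Finset.univ fun x : Σ j, Fin (T j).toList.length => (T x.1).toList.get x.2, ?_, ?_⟩
  · rw [innerFTerm, hcoef, mul_one, innerMulti_fiberPartition_of_card_eq _ ho hcard, innerSingle,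
      hsum, Finset.card_univ, hcard, Fintype.card_fin]
    congr 3
    have : ((∑ x : Σ j, Fin (T j).toList.length, (T x.1).toList.get x.2 : ℕ) : ℤ) =
      ((∑ j, m j : ℕ) : ℤ) := by rw [hsum]
    push_cast at this
    rw [this]
  · have := abs_Emap_le_of_two_le
      (fun x : Σ j, Fin (T j).toList.length => (T x.1).toList.get x.2) Finset.univ
      (fun x _ => by
        have hx := get_mem_toList (T x.1) x.2
        rw [Multiset.mem_singleton.1 hx]
        exact hm x.1)
    rwa [hsum] at this

theorem abs_innerF_sub_innerFTerm_le (hm : ∀ j, 2 ≤ m j) (hn : 0 < n) :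
    |innerF m - innerFTerm m (fun j => {m j})| ≤
      9 * Real.exp 36 * Real.exp (3 * (9 * Real.exp 36 * 121 * 18 * 18)) *
        ((∑ j, m j - 1)! : ℝ) := by
  have hmem : (fun j => {m j}) ∈ Fintype.piFinset fun j : Fin n => partitionsOfWeight (m j + 1) :=
    Fintype.mem_piFinset.2 fun j => singleton_mem_partitionsOfWeight (by have := hm j; omega)
  have hN : 0 < ∑ j, m j :=
    Finset.sum_pos (fun j _ => by have := hm j; omega) ⟨⟨0, hn⟩, Finset.mem_univ _⟩
  rw [innerF_eq_sum, ← Finset.add_sum_erase _ _ hmem, add_sub_cancel_left]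
  refine (Finset.abs_sum_le_sum_abs _ _).trans ?_
  have hterm : ∀ T ∈ (Fintype.piFinset fun j : Fin n => partitionsOfWeight (m j + 1)).erase
      (fun j => {m j}), |innerFTerm m T| ≤ 9 * Real.exp 36 * ((∑ j, m j - 1)! : ℝ) *
        ∏ j, partitionFactor
          (9 * Real.exp 36 * 121 * 18 * 18 * m j / ((∑ j, m j : ℕ) : ℝ)) (T j) := by
    intro T hT
    obtain ⟨hne, hT⟩ := Finset.mem_erase.1 hT
    have hT := Fintype.mem_piFinset.1 hT
    exact abs_term_le hm hT (exists_two_le_card_of_ne hT hne)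
  refine (Finset.sum_le_sum hterm).trans ?_
  have hsub := Finset.sum_le_sum_of_subset_of_nonneg
    (f := fun T : Fin n → Multiset ℕ => ∏ j, partitionFactor
      (9 * Real.exp 36 * 121 * 18 * 18 * m j / ((∑ j, m j : ℕ) : ℝ)) (T j))
    (Finset.erase_subset (fun j => {m j})
      (Fintype.piFinset fun j : Fin n => partitionsOfWeight (m j + 1)))
    (fun T _ _ => Finset.prod_nonneg fun j _ => partitionFactor_nonneg (by positivity) _)
  rw [← Finset.mul_sum]
  calc _ ≤ 9 * Real.exp 36 * ((∑ j, m j - 1)! : ℝ) *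
        Real.exp (3 * (9 * Real.exp 36 * 121 * 18 * 18)) :=
        mul_le_mul_of_nonneg_left
          (hsub.trans (sum_prod_partitionFactor_le (by positivity) hN)) (by positivity)
    _ = _ := by ring

end MainTerm

theorem Real.exp_natCast_le_two_pow (a : ℕ) : Real.exp a ≤ 2 ^ (2 * a) := by
  rw [← Real.exp_one_pow, pow_mul]
  exact pow_le_pow_left₀ (Real.exp_pos 1).le (by linarith [Real.exp_one_lt_d9]) a

theorem error_constant_le :
    2 + 648 * Real.exp 36 +
      9 * Real.exp 36 * Real.exp (3 * (9 * Real.exp 36 * 121 * 18 * 18)) ≤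
    (2 : ℝ) ^ (2 ^ 200) := by
  have h36 : Real.exp 36 ≤ 2 ^ 72 := by
    have := Real.exp_natCast_le_two_pow 36
    norm_num at this ⊢
    exact this
  have hM : Real.exp (3 * (9 * Real.exp 36 * 121 * 18 * 18)) ≤ 2 ^ (2 * 2 ^ 93) := by
    refine le_trans (Real.exp_le_exp.2 ?_) (Real.exp_natCast_le_two_pow (2 ^ 93))
    push_cast
    norm_num at h36 ⊢
    linarith
  have hX : (2 : ℝ) ^ 100 ≤ 2 ^ (2 * 2 ^ 93) := pow_le_pow_right₀ (by norm_num) (by norm_num)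
  have hXX : ((2 : ℝ) ^ (2 * 2 ^ 93)) * 2 ^ (2 * 2 ^ 93) ≤ 2 ^ (2 ^ 200) := by
    rw [← pow_add]
    exact pow_le_pow_right₀ (by norm_num) (by norm_num)
  refine le_trans ?_ hXX
  generalize (2 : ℝ) ^ (2 * 2 ^ 93) = X at hM hX
  have h0 := Real.exp_pos 36
  have h1 : 9 * Real.exp 36 * Real.exp (3 * (9 * Real.exp 36 * 121 * 18 * 18)) ≤
      9 * 2 ^ 72 * X := by
    gcongr
  have h2 : (2 : ℝ) ^ 100 * X ≤ X * X := mul_le_mul_of_nonneg_right hX (le_trans (by positivity) hX)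
  norm_num at h36 hX h1 h2 ⊢
  linarith

/-- Let `g > 1` and let `m = (m₁, …, m_n)` be a partition
(a nonincreasing tuple) of `2g + n − 2` with every `m_i ≥ 2`.  Then
`|⟨F_{m₁} | ⋯ | F_{m_n}⟩ − 2·|m|!| ≤ 2^{2^{200}} · (|m| − 1)!`, and consequently the
quantity `c(m) = (1/|m|!) · ⟨F_{m₁}|⋯|F_{m_n}⟩ / ∏ m_i` satisfies
`|c(m) · ∏ m_i − 2| ≤ 2^{2^{200}} / g`. -/
theorem abs_innerF_sub_two_le (g n : ℕ) (hg : 1 < g) (m : Fin n → ℕ)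
    (hm : ∀ i, 2 ≤ m i) (hanti : ∀ i j : Fin n, i ≤ j → m j ≤ m i)
    (hsum : ∑ i, m i = 2 * g + n - 2) :
    |innerF m - 2 * ((∑ i, m i)! : ℝ)| ≤ 2 ^ (2 ^ 200) * (((∑ i, m i) - 1)! : ℝ) ∧
    |(innerF m / (((∑ i, m i)! : ℝ) * ∏ i, (m i : ℝ))) * (∏ i, (m i : ℝ)) - 2| ≤
      2 ^ (2 ^ 200) / (g : ℝ) := by
  set N := ∑ i, m i with hN
  have hn : 0 < n := by
    rcases Nat.eq_zero_or_pos n with rfl | h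
    · simp only [Finset.univ_eq_empty, Finset.sum_empty] at hN
      omega
    · exact h
  have hn2 : n * 2 ≤ N := by
    have := Finset.card_nsmul_le_sum Finset.univ m 2 fun i _ => hm i
    simpa using this
  obtain ⟨E, hterm, hE⟩ := innerFTerm_singleton hm hn
  have hrest := abs_innerF_sub_innerFTerm_le hm hn
  rw [← hN] at hE hrest
  have hfact : (N ! : ℝ) = N * ((N - 1)! : ℝ) := by
    exact_mod_cast (Nat.mul_factorial_pred (by omega : N ≠ 0)).symm
  have hzed : |zed ((∑ j, m j : ℤ) - n + 2) - 2| ≤ (1 / 2) ^ (2 * g - 2) := by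
    have hk : (∑ j, m j : ℤ) - n + 2 = ((2 * g - 2 + 2 : ℕ) : ℤ) := by
      have : (∑ j, m j : ℤ) = (N : ℤ) := by
        rw [hN]
        push_cast
        rfl
      rw [this]
      omega
    rw [hk]
    exact abs_zed_sub_two_le ⟨g - 1, by omega⟩
  have hlead : |(N ! : ℝ) * zed ((∑ j, m j : ℤ) - n + 2) - 2 * (N ! : ℝ)| ≤
      2 * ((N - 1)! : ℝ) := by
    rw [mul_comm 2 (N ! : ℝ), ← mul_sub, abs_mul, Nat.abs_cast]
    have hN2 : (N : ℝ) * (1 / 2) ^ (2 * g - 2) ≤ 2 := by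
      have h1 : N ≤ 2 * 2 ^ (2 * g - 2) := by
        have := Nat.lt_two_pow_self (n := 2 * g - 2)
        omega
      rw [one_div, inv_pow, ← div_eq_mul_inv, div_le_iff₀ (by positivity)]
      exact_mod_cast h1
    calc (N ! : ℝ) * |zed ((∑ j, m j : ℤ) - n + 2) - 2|
        ≤ (N * ((N - 1)! : ℝ)) * (1 / 2) ^ (2 * g - 2) := by
          rw [hfact]
          exact mul_le_mul_of_nonneg_left hzed (by positivity)
      _ = (N * (1 / 2) ^ (2 * g - 2)) * ((N - 1)! : ℝ) := by ring
      _ ≤ 2 * ((N - 1)! : ℝ) := mul_le_mul_of_nonneg_right hN2 (by positivity)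
  have hconst := error_constant_le
  generalize (2 : ℝ) ^ (2 ^ 200) = K at hconst ⊢
  have hK := mul_le_mul_of_nonneg_right hconst (Nat.cast_nonneg (α := ℝ) (N - 1)!)
  have hmain : |innerF m - 2 * (N ! : ℝ)| ≤ K * ((N - 1)! : ℝ) := by
    have hsplit : innerF m - 2 * (N ! : ℝ) = (innerF m - innerFTerm m (fun j => {m j})) +
        ((N ! : ℝ) * zed ((∑ j, m j : ℤ) - n + 2) - 2 * (N ! : ℝ)) + E := by
      rw [hterm]
      ring
    rw [hsplit]
    refine (abs_add_three _ _ _).trans (le_trans ?_ hK)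
    linarith
  refine ⟨hmain, ?_⟩
  have hprod : ∏ i, (m i : ℝ) ≠ 0 := Finset.prod_ne_zero_iff.2 fun i _ => by
    have := hm i
    have : m i ≠ 0 := by omega
    exact_mod_cast this
  have hfac0 : (0 : ℝ) < (N ! : ℝ) := by positivity
  have hpred0 : (0 : ℝ) < ((N - 1)! : ℝ) := by positivity
  have hg0 : (0 : ℝ) < g := by
    have : 0 < g := by omega
    exact_mod_cast this
  have hgN : (g : ℝ) ≤ N := by
    have : g ≤ N := by omega
    exact_mod_cast this
  have hK0 : 0 ≤ K := le_trans (by positivity) hconst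
  have heq : innerF m / ((N ! : ℝ) * ∏ i, (m i : ℝ)) * (∏ i, (m i : ℝ)) - 2 =
      (innerF m - 2 * (N ! : ℝ)) / (N ! : ℝ) := by
    field_simp
  rw [heq, abs_div, abs_of_pos hfac0]
  calc |innerF m - 2 * (N ! : ℝ)| / (N ! : ℝ) ≤ K * ((N - 1)! : ℝ) / (N ! : ℝ) := by gcongr
    _ = K / N := by
        rw [hfact]
        exact mul_div_mul_right K (N : ℝ) hpred0.ne'
    _ ≤ K / g := by gcongr
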